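/- Let (Π_n)_{n≥1} be any sequence of partitions of [0,T] whose mesh |Π_n| tends to 0 as n → ∞. Then there exist a subsequence of partitions, again denoted (Π_n)_{n≥1}, and bounded Lipschitz functions V, U : [0,T] × ℝ^d → ℝ such that (V^{Π_n}, U^{Π_n}) → (V, U) uniformly on compact subsets of [0,T] × ℝ^d. -/

import Mathlib

open MeasureTheory Set Filter Topology
open scoped unitInterval RealInnerProductSpace ENNReal NNReal

noncomputable section

namespace DGameFormal

/-! ### The canonical sample space `Ω = ([0,1]²)^ℕ` -/

/-- The sample space `Ω = ([0,1]²)^ℕ`.  The `j`-th coordinate mapping `ζ_{j+1}` of the paper is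
`ω ↦ ω j` (we use `0`-based indexing, so the paper's `ζ_j`, `j ≥ 1`, is `ω ↦ ω (j-1)`). -/
abbrev Omega : Type := ℕ → (I × I)

/-- `𝓕_j`: the σ-field generated by the first `j` coordinate mappings `ζ_1, …, ζ_j`. -/
def Fsig (j : ℕ) : MeasurableSpace Omega :=
  MeasurableSpace.comap (fun ω (i : Fin j) => ω (i : ℕ)) inferInstance

/-- `𝓖_{j+1}`: the σ-field generated by the first component of the coordinate `ζ_{j+1}`. -/
def Gsig (j : ℕ) : MeasurableSpace Omega :=
  MeasurableSpace.comap (fun ω => (ω j).1) inferInstance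

/-- `𝓗_{j+1}`: the σ-field generated by the second component of the coordinate `ζ_{j+1}`. -/
def Hsig (j : ℕ) : MeasurableSpace Omega :=
  MeasurableSpace.comap (fun ω => (ω j).2) inferInstance

/-- `P` is the countable product `λ₂^{⊗ℕ}` of the two-dimensional Lebesgue (Borel) measure on the
unit square: it has the prescribed finite-dimensional distributions. -/
def IsProductMeasure (P : Measure Omega) : Prop :=
  ∀ m : ℕ, P.map (fun ω (i : Fin m) => ω (i : ℕ))
      = Measure.pi (fun _ : Fin m => (volume : Measure (I × I)))

/-! ### Partitions of `[0,T]` -/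

/-- A partition `0 = t_0 < t_1 < ⋯ < t_n = T` of the interval `[0,T]`. -/
structure Partition (T : ℝ) where
  n : ℕ
  npos : 0 < n
  t : ℕ → ℝ
  map_zero : t 0 = 0
  map_last : t n = T
  mono : ∀ i < n, t i < t (i + 1)

/-- The mesh `|Π|`: the maximal distance between two neighbouring points of the partition. -/
def Partition.mesh {T : ℝ} (π : Partition T) : ℝ :=
  (Finset.range π.n).sup' (Finset.nonempty_range_iff.2 π.npos.ne') fun i => π.t (i + 1) - π.t i

open scoped Classical in
/-- For `t ∈ [t_i, t_{i+1})` the index `i` (and `n - 1` for `t ≥ t_{n-1}`). -/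
def Partition.idx {T : ℝ} (π : Partition T) (s : ℝ) : ℕ :=
  Nat.findGreatest (fun i => π.t i ≤ s) (π.n - 1)

/-! ### Admissible controls along a partition -/

variable (U V : Type) [MeasurableSpace U] [MeasurableSpace V]

/-- Admissible controls for Player 1 along the partition `π`: measurable processes `u` such that on
each interval `[t_{j-1}, t_j)` of the partition, `u` is a countable sum `Σ_k 1_{Γ_{j,k}} u^{j,k}`
where `(Γ_{j,k})_k ⊆ 𝓕_{j-1}` is a partition of `Ω` and each `u^{j,k}` is `𝓖_j`-measurable. -/
def AdmControl1 {T : ℝ} (π : Partition T) : Set (ℝ → Omega → U) :=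
  {u | Measurable (Function.uncurry u) ∧
    ∀ j < π.n, ∃ (Γ : ℕ → Set Omega) (w : ℕ → ℝ → Omega → U),
      (∀ k, MeasurableSet[Fsig j] (Γ k)) ∧
      Pairwise (Function.onFun Disjoint Γ) ∧
      (⋃ k, Γ k) = univ ∧
      (∀ k s, Measurable[Gsig j] (w k s)) ∧
      (∀ k, ∀ ω ∈ Γ k, ∀ s ∈ Ico (π.t j) (π.t (j + 1)), u s ω = w k s ω)}

/-- Admissible controls for Player 2 along the partition `π` (with `𝓗_j` in place of `𝓖_j`). -/
def AdmControl2 {T : ℝ} (π : Partition T) : Set (ℝ → Omega → V) :=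
  {v | Measurable (Function.uncurry v) ∧
    ∀ j < π.n, ∃ (Γ : ℕ → Set Omega) (w : ℕ → ℝ → Omega → V),
      (∀ k, MeasurableSet[Fsig j] (Γ k)) ∧
      Pairwise (Function.onFun Disjoint Γ) ∧
      (⋃ k, Γ k) = univ ∧
      (∀ k s, Measurable[Hsig j] (w k s)) ∧
      (∀ k, ∀ ω ∈ Γ k, ∀ s ∈ Ico (π.t j) (π.t (j + 1)), v s ω = w k s ω)}

/-! ### Nonanticipative strategies with delay (NAD strategies) -/

/-- A stopping time `τ : Ω → {0, 1, …, n-1}` of the discrete filtration `(𝓕_j)_j`. -/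
def IsStoppingIdx {T : ℝ} (π : Partition T) (τ : Omega → ℕ) : Prop :=
  (∀ ω, τ ω < π.n) ∧ ∀ j, MeasurableSet[Fsig j] {ω | τ ω = j}

variable {U V}

/-- `u = u'`, `ds⊗dP`-a.e. on the stochastic interval `[[t, b]] = {(s,ω) | t ≤ s ≤ b ω}`. -/
def aeStEq {α : Type*} (P : Measure Omega) (t : ℝ) (b : Omega → ℝ)
    (u u' : ℝ → Omega → α) : Prop :=
  ∀ᵐ p ∂((volume : Measure ℝ).prod P), t ≤ p.1 → p.1 ≤ b p.2 → u p.1 p.2 = u' p.1 p.2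

/-- `u = u'`, `ds⊗dP`-a.e. on `[a,b] × Ω`. -/
def aeEqIcc {α : Type*} (P : Measure Omega) (a b : ℝ) (u u' : ℝ → Omega → α) : Prop :=
  ∀ᵐ p ∂((volume : Measure ℝ).prod P), p.1 ∈ Icc a b → u p.1 p.2 = u' p.1 p.2

variable (U V)

/-- NAD strategies for Player 1 on `[t,T]` along `π`: maps from admissible controls of Player 2 to
admissible controls of Player 1 such that controls agreeing `ds⊗dP`-a.e. on `[[t, t_τ]]`, for a
stopping time `τ`, are mapped to controls agreeing `ds⊗dP`-a.e. on `[[t, t_{τ+1}]]`. -/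
def IsNAD1 {T : ℝ} (P : Measure Omega) (π : Partition T) (t : ℝ)
    (α : (ℝ → Omega → V) → (ℝ → Omega → U)) : Prop :=
  (∀ v ∈ AdmControl2 V π, α v ∈ AdmControl1 U π) ∧
  ∀ τ : Omega → ℕ, IsStoppingIdx π τ →
    ∀ v v', v ∈ AdmControl2 V π → v' ∈ AdmControl2 V π →
      aeStEq P t (fun ω => π.t (τ ω)) v v' →
      aeStEq P t (fun ω => π.t (τ ω + 1)) (α v) (α v')

/-- NAD strategies for Player 2 on `[t,T]` along `π`. -/
def IsNAD2 {T : ℝ} (P : Measure Omega) (π : Partition T) (t : ℝ)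
    (β : (ℝ → Omega → U) → (ℝ → Omega → V)) : Prop :=
  (∀ u ∈ AdmControl1 U π, β u ∈ AdmControl2 V π) ∧
  ∀ τ : Omega → ℕ, IsStoppingIdx π τ →
    ∀ u u', u ∈ AdmControl1 U π → u' ∈ AdmControl1 U π →
      aeStEq P t (fun ω => π.t (τ ω)) u u' →
      aeStEq P t (fun ω => π.t (τ ω + 1)) (β u) (β u')

/-! ### The controlled dynamics -/

variable {U V}
variable {d : ℕ}

/-- `X` is the (continuous) solution on `[t,T]` of `X_s = x + ∫_t^s f(r, X_r, u_r, v_r) dr`. -/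
def IsSol (f : ℝ → EuclideanSpace ℝ (Fin d) → U → V → EuclideanSpace ℝ (Fin d)) (T t : ℝ)
    (x : EuclideanSpace ℝ (Fin d)) (u : ℝ → U) (v : ℝ → V)
    (X : ℝ → EuclideanSpace ℝ (Fin d)) : Prop :=
  ContinuousOn X (Icc t T) ∧ ∀ s ∈ Icc t T, X s = x + ∫ r in t..s, f r (X r) (u r) (v r)

/-- The solution `X^{t,x,u,v}` (chosen via the axiom of choice; under the standing assumptions it
is the unique continuous solution). -/
def sol (f : ℝ → EuclideanSpace ℝ (Fin d) → U → V → EuclideanSpace ℝ (Fin d)) (T t : ℝ)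
    (x : EuclideanSpace ℝ (Fin d)) (u : ℝ → U) (v : ℝ → V) : ℝ → EuclideanSpace ℝ (Fin d) :=
  Classical.epsilon (IsSol f T t x u v)

/-- `(u,v)` is the couple of admissible controls associated with the couple of NAD strategies
`(α,β)` on `[t, tl]`:  `α(v) = u` and `β(u) = v`, `ds⊗dP`-a.e. on `[t,tl] × Ω`. -/
def IsFixPair {T : ℝ} (P : Measure Omega) (π : Partition T) (t tl : ℝ)
    (α : (ℝ → Omega → V) → (ℝ → Omega → U)) (β : (ℝ → Omega → U) → (ℝ → Omega → V))
    (u : ℝ → Omega → U) (v : ℝ → Omega → V) : Prop :=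
  u ∈ AdmControl1 U π ∧ v ∈ AdmControl2 V π ∧ aeEqIcc P t tl (α v) u ∧ aeEqIcc P t tl (β u) v

variable [Nonempty U] [Nonempty V]

/-- The couple of admissible controls associated with a couple of NAD strategies on `[t,tl]`
(chosen via the axiom of choice; by Lemma 2.1 it exists and is `ds⊗dP`-a.e. unique). -/
def fixPair {T : ℝ} (P : Measure Omega) (π : Partition T) (t tl : ℝ)
    (α : (ℝ → Omega → V) → (ℝ → Omega → U)) (β : (ℝ → Omega → U) → (ℝ → Omega → V)) :
    (ℝ → Omega → U) × (ℝ → Omega → V) :=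
  Classical.epsilon fun p => IsFixPair P π t tl α β p.1 p.2

/-- The state process `X^{t,x,α,β}` associated with a couple of NAD strategies on `[t,tl]`. -/
def solStrat (f : ℝ → EuclideanSpace ℝ (Fin d) → U → V → EuclideanSpace ℝ (Fin d)) {T : ℝ}
    (P : Measure Omega) (π : Partition T) (t tl : ℝ) (x : EuclideanSpace ℝ (Fin d))
    (α : (ℝ → Omega → V) → (ℝ → Omega → U)) (β : (ℝ → Omega → U) → (ℝ → Omega → V))
    (s : ℝ) (ω : Omega) : EuclideanSpace ℝ (Fin d) :=
  sol f T t x (fun r => (fixPair P π t tl α β).1 r ω) (fun r => (fixPair P π t tl α β).2 r ω) s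

/-- The terminal pay-off `g(X_T^{t,x,α,β})`. -/
def payoff (f : ℝ → EuclideanSpace ℝ (Fin d) → U → V → EuclideanSpace ℝ (Fin d))
    (g : EuclideanSpace ℝ (Fin d) → ℝ) {T : ℝ} (P : Measure Omega) (π : Partition T)
    (t : ℝ) (x : EuclideanSpace ℝ (Fin d))
    (α : (ℝ → Omega → V) → (ℝ → Omega → U)) (β : (ℝ → Omega → U) → (ℝ → Omega → V)) :
    Omega → ℝ :=
  fun ω => g (solStrat f P π t T x α β T ω)

/-! ### Essential suprema/infima of families of random variables -/

/-- `S` is the `P`-a.s. least upper bound of the family `(ξ_i)_{i}` of random variables. -/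
def IsEssSupFam {ι : Sort*} (P : Measure Omega) (ξ : ι → Omega → ℝ) (S : Omega → ℝ) : Prop :=
  (∀ i, ξ i ≤ᵐ[P] S) ∧ ∀ W : Omega → ℝ, (∀ i, ξ i ≤ᵐ[P] W) → S ≤ᵐ[P] W

/-- `S` is the `P`-a.s. greatest lower bound of the family `(ξ_i)_{i}` of random variables. -/
def IsEssInfFam {ι : Sort*} (P : Measure Omega) (ξ : ι → Omega → ℝ) (S : Omega → ℝ) : Prop :=
  (∀ i, S ≤ᵐ[P] ξ i) ∧ ∀ W : Omega → ℝ, (∀ i, W ≤ᵐ[P] ξ i) → W ≤ᵐ[P] S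

/-! ### Value functions along a partition -/

variable (U V)

/-- The defining property of the lower value function along `π`:
`S = esssup_{α} essinf_{β} E[g(X_T^{t,x,α,β}) | 𝓕_i]` for `t_i ≤ t < t_{i+1}`. -/
def IsLowerVal (f : ℝ → EuclideanSpace ℝ (Fin d) → U → V → EuclideanSpace ℝ (Fin d))
    (g : EuclideanSpace ℝ (Fin d) → ℝ) {T : ℝ} (P : Measure Omega) (π : Partition T)
    (t : ℝ) (x : EuclideanSpace ℝ (Fin d)) (S : Omega → ℝ) : Prop :=
  ∃ J : {α // IsNAD1 U V P π t α} → Omega → ℝ,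
    (∀ α, IsEssInfFam P
      (fun β : {β // IsNAD2 U V P π t β} => P[payoff f g P π t x α.1 β.1 | Fsig (π.idx t)])
      (J α)) ∧
    IsEssSupFam P J S

/-- The defining property of the upper value function along `π`. -/
def IsUpperVal (f : ℝ → EuclideanSpace ℝ (Fin d) → U → V → EuclideanSpace ℝ (Fin d))
    (g : EuclideanSpace ℝ (Fin d) → ℝ) {T : ℝ} (P : Measure Omega) (π : Partition T)
    (t : ℝ) (x : EuclideanSpace ℝ (Fin d)) (S : Omega → ℝ) : Prop :=
  ∃ J : {β // IsNAD2 U V P π t β} → Omega → ℝ,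
    (∀ β, IsEssSupFam P
      (fun α : {α // IsNAD1 U V P π t α} => P[payoff f g P π t x α.1 β.1 | Fsig (π.idx t)])
      (J β)) ∧
    IsEssInfFam P J S

/-- The lower value function along `π` seen as a random variable. -/
def lowerVal (f : ℝ → EuclideanSpace ℝ (Fin d) → U → V → EuclideanSpace ℝ (Fin d))
    (g : EuclideanSpace ℝ (Fin d) → ℝ) {T : ℝ} (P : Measure Omega) (π : Partition T)
    (t : ℝ) (x : EuclideanSpace ℝ (Fin d)) : Omega → ℝ :=
  Classical.epsilon (IsLowerVal U V f g P π t x)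

/-- The upper value function along `π` seen as a random variable. -/
def upperVal (f : ℝ → EuclideanSpace ℝ (Fin d) → U → V → EuclideanSpace ℝ (Fin d))
    (g : EuclideanSpace ℝ (Fin d) → ℝ) {T : ℝ} (P : Measure Omega) (π : Partition T)
    (t : ℝ) (x : EuclideanSpace ℝ (Fin d)) : Omega → ℝ :=
  Classical.epsilon (IsUpperVal U V f g P π t x)

/-- The (deterministic) lower value function along `π`: the expectation of `lowerVal`. -/
def lowerValD (f : ℝ → EuclideanSpace ℝ (Fin d) → U → V → EuclideanSpace ℝ (Fin d))
    (g : EuclideanSpace ℝ (Fin d) → ℝ) {T : ℝ} (P : Measure Omega) (π : Partition T)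
    (t : ℝ) (x : EuclideanSpace ℝ (Fin d)) : ℝ :=
  ∫ ω, lowerVal U V f g P π t x ω ∂P

/-- The (deterministic) upper value function along `π`: the expectation of `upperVal`. -/
def upperValD (f : ℝ → EuclideanSpace ℝ (Fin d) → U → V → EuclideanSpace ℝ (Fin d))
    (g : EuclideanSpace ℝ (Fin d) → ℝ) {T : ℝ} (P : Measure Omega) (π : Partition T)
    (t : ℝ) (x : EuclideanSpace ℝ (Fin d)) : ℝ :=
  ∫ ω, upperVal U V f g P π t x ω ∂P

/-! ### The Hamiltonian and viscosity solutions -/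

section Hamiltonian

variable (U V : Type) [MetricSpace U] [MetricSpace V] [MeasurableSpace U] [MeasurableSpace V]

/-- `f̃(t,x,μ,ν) = ∫_U ∫_V f(t,x,u,v) μ(du) ν(dv)` for mixed actions `μ ∈ Δ(U)`, `ν ∈ Δ(V)`. -/
def ftilde (f : ℝ → EuclideanSpace ℝ (Fin d) → U → V → EuclideanSpace ℝ (Fin d))
    (t : ℝ) (x : EuclideanSpace ℝ (Fin d)) (μ : ProbabilityMeasure U) (ν : ProbabilityMeasure V) :
    EuclideanSpace ℝ (Fin d) :=
  ∫ u, ∫ v, f t x u v ∂(ν : Measure V) ∂(μ : Measure U)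

/-- The Hamiltonian `sup_{μ ∈ ΔU} inf_{ν ∈ ΔV} f̃(t,x,μ,ν)·p`. -/
def ham (f : ℝ → EuclideanSpace ℝ (Fin d) → U → V → EuclideanSpace ℝ (Fin d))
    (t : ℝ) (x p : EuclideanSpace ℝ (Fin d)) : ℝ :=
  ⨆ μ : ProbabilityMeasure U, ⨅ ν : ProbabilityMeasure V, ⟪ftilde U V f t x μ ν, p⟫

/-- Viscosity subsolution of `∂_t W + sup_μ inf_ν f̃(t,x,μ,ν)·∇W = 0`, `W(T,·) = g`, on
`[0,T] × ℝ^d`. -/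
def IsViscSubsol (f : ℝ → EuclideanSpace ℝ (Fin d) → U → V → EuclideanSpace ℝ (Fin d))
    (g : EuclideanSpace ℝ (Fin d) → ℝ) (T : ℝ) (W : ℝ → EuclideanSpace ℝ (Fin d) → ℝ) : Prop :=
  (∀ x, W T x ≤ g x) ∧
  ∀ φ : ℝ → EuclideanSpace ℝ (Fin d) → ℝ,
    ContDiff ℝ 1 (fun q : ℝ × EuclideanSpace ℝ (Fin d) => φ q.1 q.2) →
    ∀ t x, t ∈ Ico (0 : ℝ) T →
      IsLocalMaxOn (fun q : ℝ × EuclideanSpace ℝ (Fin d) => W q.1 q.2 - φ q.1 q.2)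
        (Icc (0 : ℝ) T ×ˢ univ) (t, x) →
      0 ≤ deriv (fun s => φ s x) t + ham U V f t x (gradient (fun y => φ t y) x)

/-- Viscosity supersolution of `∂_t W + sup_μ inf_ν f̃(t,x,μ,ν)·∇W = 0`, `W(T,·) = g`, on
`[0,T] × ℝ^d`. -/
def IsViscSupersol (f : ℝ → EuclideanSpace ℝ (Fin d) → U → V → EuclideanSpace ℝ (Fin d))
    (g : EuclideanSpace ℝ (Fin d) → ℝ) (T : ℝ) (W : ℝ → EuclideanSpace ℝ (Fin d) → ℝ) : Prop :=
  (∀ x, g x ≤ W T x) ∧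
  ∀ φ : ℝ → EuclideanSpace ℝ (Fin d) → ℝ,
    ContDiff ℝ 1 (fun q : ℝ × EuclideanSpace ℝ (Fin d) => φ q.1 q.2) →
    ∀ t x, t ∈ Ico (0 : ℝ) T →
      IsLocalMinOn (fun q : ℝ × EuclideanSpace ℝ (Fin d) => W q.1 q.2 - φ q.1 q.2)
        (Icc (0 : ℝ) T ×ˢ univ) (t, x) →
      deriv (fun s => φ s x) t + ham U V f t x (gradient (fun y => φ t y) x) ≤ 0

end Hamiltonian

/-! ### Integral equations with measurable, bounded and Lipschitz right-hand side -/

section IntegralEquation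

variable {E : Type*} [NormedAddCommGroup E]

theorem intervalIntegrable_of_Icc {F : ℝ → E} {a b c e : ℝ} (hF : IntegrableOn F (Icc a b))
    (hac : a ≤ c) (hce : c ≤ e) (heb : e ≤ b) : IntervalIntegrable F volume c e :=
  (intervalIntegrable_iff_integrableOn_Icc_of_le hce).2
    (hF.mono_set (Icc_subset_Icc hac heb))

variable [MeasurableSpace E] [BorelSpace E] [SecondCountableTopology E]

theorem integrableOn_comp_of_bounded {h : ℝ → E → E} {C : ℝ}
    (hm : Measurable (Function.uncurry h)) (hb : ∀ r y, ‖h r y‖ ≤ C) {a b : ℝ} {X : ℝ → E}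
    (hX : AEMeasurable X (volume.restrict (Icc a b))) :
    IntegrableOn (fun r => h r (X r)) (Icc a b) := by
  refine Integrable.of_bound (C := C) ?_ (Eventually.of_forall fun r => hb _ _)
  exact (hm.comp_aemeasurable (aemeasurable_id.prodMk hX)).aestronglyMeasurable

variable [NormedSpace ℝ E]

/-- `X` is a continuous solution on `[a,b]` of `X_s = x + ∫_a^s h(r, X_r) dr`. -/
def IsIntSol (h : ℝ → E → E) (a b : ℝ) (x : E) (X : ℝ → E) : Prop :=
  ContinuousOn X (Icc a b) ∧ ∀ s ∈ Icc a b, X s = x + ∫ r in a..s, h r (X r)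

theorem le_mul_exp_of_le_add_integral {φ : ℝ → ℝ} {a b δ K : ℝ} (hK : 0 ≤ K)
    (hc : ContinuousOn φ (Icc a b))
    (h : ∀ s ∈ Icc a b, φ s ≤ δ + K * ∫ r in a..s, φ r) :
    ∀ s ∈ Icc a b, φ s ≤ δ * Real.exp (K * (s - a)) := by
  intro s hs
  have hab : a ≤ b := hs.1.trans hs.2
  have hinteg : IntervalIntegrable φ volume a b :=
    (by rwa [uIcc_of_le hab] : ContinuousOn φ (uIcc a b)).intervalIntegrable
  have key := le_gronwallBound_of_liminf_deriv_right_le (f := fun s => δ + K * ∫ r in a..s, φ r)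
    (f' := fun s => K * φ s) (δ := δ) (K := K) (ε := 0) (a := a) (b := b) ?_ ?_ ?_ ?_ s hs
  · rw [gronwallBound_ε0] at key
    exact (h s hs).trans key
  · have := intervalIntegral.continuousOn_primitive_interval (μ := volume)
      ((uIcc_of_le hab).symm ▸ (intervalIntegrable_iff_integrableOn_Icc_of_le hab).1 hinteg)
    rw [uIcc_of_le hab] at this
    exact continuousOn_const.add (continuousOn_const.mul this)
  · intro y hy r hr
    have hd : HasDerivWithinAt (fun s => ∫ r in a..s, φ r) (φ y) (Ici y) y := by
      have hI : IntervalIntegrable φ volume a y := by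
        apply hinteg.mono_set
        rw [uIcc_of_le hab, uIcc_of_le hy.1]
        exact Icc_subset_Icc_right hy.2.le
      have hnb : Ioo y b ∈ 𝓝[>] y := Ioo_mem_nhdsGT hy.2
      refine intervalIntegral.integral_hasDerivWithinAt_right hI (t := Ioi y) ?_ ?_
      · refine ⟨Ioo y b, hnb, ?_⟩
        exact (hc.mono (Ioo_subset_Icc_self.trans (Icc_subset_Icc_left hy.1))
          ).aestronglyMeasurable measurableSet_Ioo
      · exact ((hc y ⟨hy.1, hy.2.le⟩).mono_of_mem_nhdsWithin (mem_of_superset hnb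
          (Ioo_subset_Icc_self.trans (Icc_subset_Icc_left hy.1))))
    have h2 : HasDerivWithinAt (fun s => δ + K * ∫ r in a..s, φ r) (K * φ y) (Ici y) y :=
      (hd.const_mul K).const_add δ
    simpa only [slope_def_field, div_eq_inv_mul] using! h2.liminf_right_slope_le hr
  · simp
  · intro y hy
    rw [add_zero]
    exact mul_le_mul_of_nonneg_left (h y ⟨hy.1, hy.2.le⟩) hK

theorem norm_sub_le_of_isIntSol {h h' : ℝ → E → E} {C : ℝ} {K : ℝ≥0}
    (hm : Measurable (Function.uncurry h)) (hb : ∀ r y, ‖h r y‖ ≤ C)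
    (hm' : Measurable (Function.uncurry h')) (hb' : ∀ r y, ‖h' r y‖ ≤ C)
    (hl : ∀ r, LipschitzWith K (h r))
    {a a' b : ℝ} (ha : a ≤ a') (hab : a' ≤ b) {x x' : E} {X X' : ℝ → E}
    (hh : ∀ᵐ r, r ∈ Icc a' b → h r = h' r)
    (hX : IsIntSol h a b x X) (hX' : IsIntSol h' a' b x' X') :
    ‖X b - X' b‖ ≤ (‖x - x'‖ + C * (a' - a)) * Real.exp (K * (b - a')) := by
  have hi : IntegrableOn (fun r => h r (X r)) (Icc a b) :=
    integrableOn_comp_of_bounded hm hb (hX.1.aemeasurable measurableSet_Icc)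
  have hi' : IntegrableOn (fun r => h' r (X' r)) (Icc a' b) :=
    integrableOn_comp_of_bounded hm' hb' (hX'.1.aemeasurable measurableSet_Icc)
  have hc : ContinuousOn (fun s => ‖X s - X' s‖) (Icc a' b) :=
    ((hX.1.mono (Icc_subset_Icc_left ha)).sub hX'.1).norm
  refine le_mul_exp_of_le_add_integral K.2 hc (fun s hs => ?_) b ⟨hab, le_rfl⟩
  rw [hX.2 s ⟨ha.trans hs.1, hs.2⟩, hX'.2 s hs, ← intervalIntegral.integral_add_adjacent_intervals
    (intervalIntegrable_of_Icc hi le_rfl ha hab)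
    (intervalIntegrable_of_Icc hi ha hs.1 hs.2)]
  have e : x + ((∫ r in a..a', h r (X r)) + ∫ r in a'..s, h r (X r))
      - (x' + ∫ r in a'..s, h' r (X' r)) = ((x - x') + ∫ r in a..a', h r (X r))
        + ((∫ r in a'..s, h r (X r)) - ∫ r in a'..s, h' r (X' r)) := by abel
  rw [e, ← intervalIntegral.integral_sub (intervalIntegrable_of_Icc hi ha hs.1 hs.2)
    (intervalIntegrable_of_Icc hi' le_rfl hs.1 hs.2)]
  refine (norm_add_le _ _).trans (add_le_add ((norm_add_le _ _).trans ?_) ?_)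
  · gcongr
    refine (intervalIntegral.norm_integral_le_of_norm_le_const fun r _ => hb r _).trans ?_
    rw [abs_of_nonneg (sub_nonneg.2 ha)]
  · rw [← intervalIntegral.integral_const_mul]
    refine intervalIntegral.norm_integral_le_of_norm_le hs.1 ?_ ?_
    · filter_upwards [hh] with r hr hrs
      rw [← hr ⟨hrs.1.le, hrs.2.trans hs.2⟩]
      simpa [dist_eq_norm] using (hl r).dist_le_mul (X r) (X' r)
    · have : ContinuousOn (fun r => (K : ℝ) * ‖X r - X' r‖) (uIcc a' s) := by
        rw [uIcc_of_le hs.1]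
        exact continuousOn_const.mul (hc.mono (Icc_subset_Icc_right hs.2))
      exact this.intervalIntegrable

variable {W : Type*}

/-- Picard iterates for the parametrised integral equation `X_s = x + ∫_a^s h(w, r, X_r) dr`. -/
def picardIter (h : W → ℝ → E → E) (a : ℝ) (x : E) : ℕ → W → ℝ → E
  | 0 => fun _ _ => x
  | k + 1 => fun w s => x + ∫ r in a..s, h w r (picardIter h a x k w r)

theorem measurable_picardIter [MeasurableSpace W] {h : W → ℝ → E → E}
    (hm : Measurable fun p : W × ℝ × E => h p.1 p.2.1 p.2.2) (a : ℝ) (x : E) (k : ℕ) :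
    Measurable fun p : W × ℝ => picardIter h a x k p.1 p.2 := by
  induction k with
  | zero => exact measurable_const
  | succ k ih =>
    simp only [picardIter, intervalIntegral, ← integral_indicator measurableSet_Ioc]
    have hF : Measurable fun q : (W × ℝ) × ℝ => h q.1.1 q.2 (picardIter h a x k q.1.1 q.2) :=
      hm.comp ((measurable_fst.comp measurable_fst).prodMk (measurable_snd.prodMk
        (ih.comp ((measurable_fst.comp measurable_fst).prodMk measurable_snd))))
    have h1 : MeasurableSet {q : (W × ℝ) × ℝ | q.2 ∈ Ioc a q.1.2} :=
      (measurableSet_lt measurable_const measurable_snd).inter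
        (measurableSet_le measurable_snd (measurable_snd.comp measurable_fst))
    have h2 : MeasurableSet {q : (W × ℝ) × ℝ | q.2 ∈ Ioc q.1.2 a} :=
      (measurableSet_lt (measurable_snd.comp measurable_fst) measurable_snd).inter
        (measurableSet_le measurable_snd measurable_const)
    have m1 := ((hF.indicator h1).stronglyMeasurable.integral_prod_right' (ν := volume)).measurable
    have m2 := ((hF.indicator h2).stronglyMeasurable.integral_prod_right' (ν := volume)).measurable
    exact measurable_const.add (m1.sub m2)

theorem norm_picardIter_succ_sub_le [MeasurableSpace W] {h : W → ℝ → E → E} {C : ℝ} {K : ℝ≥0}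
    (hm : Measurable fun p : W × ℝ × E => h p.1 p.2.1 p.2.2) (hb : ∀ w r y, ‖h w r y‖ ≤ C)
    (hl : ∀ w r, LipschitzWith K (h w r)) {a b : ℝ} (x : E) (w : W) (k : ℕ) :
    ∀ s ∈ Icc a b, ‖picardIter h a x (k + 1) w s - picardIter h a x k w s‖
      ≤ C * (b - a) * (1 / 2) ^ k * Real.exp (2 * K * (s - a)) := by
  have hi : ∀ k, ∀ s ∈ Icc a b, IntervalIntegrable (fun r => h w r (picardIter h a x k w r))
      volume a s := fun k s hs => by
    refine intervalIntegrable_of_Icc (b := b) ?_ le_rfl hs.1 hs.2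
    exact integrableOn_comp_of_bounded (h := h w) (hm.comp (measurable_const.prodMk measurable_id))
      (hb w) ((measurable_picardIter hm a x k).comp
        (measurable_const.prodMk measurable_id)).aemeasurable
  have hC : 0 ≤ C := (norm_nonneg _).trans (hb w a x)
  induction k with
  | zero =>
    intro s hs
    simp only [picardIter, add_sub_cancel_left, pow_zero, mul_one]
    refine (intervalIntegral.norm_integral_le_of_norm_le_const fun r _ => hb w r _).trans ?_
    rw [abs_of_nonneg (sub_nonneg.2 hs.1)]
    have h1 : (1 : ℝ) ≤ Real.exp (2 * K * (s - a)) :=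
      Real.one_le_exp (mul_nonneg (by positivity) (sub_nonneg.2 hs.1))
    have h2 : C * (s - a) ≤ C * (b - a) := by gcongr; exact hs.2
    have h3 : 0 ≤ C * (s - a) := mul_nonneg hC (sub_nonneg.2 hs.1)
    nlinarith
  | succ k ih =>
    intro s hs
    have e : picardIter h a x (k + 1 + 1) w s - picardIter h a x (k + 1) w s
        = ∫ r in a..s, (h w r (picardIter h a x (k + 1) w r) - h w r (picardIter h a x k w r)) := by
      rw [intervalIntegral.integral_sub (hi _ s hs) (hi _ s hs)]
      simp only [picardIter]
      abel
    rw [e]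
    have hd : ∀ r, HasDerivAt (fun r => C * (b - a) * (1 / 2) ^ (k + 1) *
        Real.exp (2 * K * (r - a)))
        (K * (C * (b - a) * (1 / 2) ^ k * Real.exp (2 * K * (r - a)))) r := fun r => by
      have := ((((hasDerivAt_id r).sub_const a).const_mul (2 * (K : ℝ))).exp).const_mul
        (C * (b - a) * (1 / 2) ^ (k + 1))
      refine this.congr_deriv ?_
      simp only [id, pow_succ]
      ring
    have hcont : Continuous fun r : ℝ =>
        K * (C * (b - a) * (1 / 2) ^ k * Real.exp (2 * K * (r - a))) := by fun_prop
    refine (intervalIntegral.norm_integral_le_of_norm_le (g := fun r =>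
      K * (C * (b - a) * (1 / 2) ^ k * Real.exp (2 * K * (r - a)))) hs.1 ?_
      (hcont.intervalIntegrable _ _)).trans ?_
    · refine Eventually.of_forall fun r hr => ?_
      refine le_trans ?_ (mul_le_mul_of_nonneg_left (ih r ⟨hr.1.le, hr.2.trans hs.2⟩) K.2)
      simpa [dist_eq_norm] using (hl w r).dist_le_mul (picardIter h a x (k + 1) w r)
        (picardIter h a x k w r)
    · rw [intervalIntegral.integral_eq_sub_of_hasDerivAt (fun r _ => hd r)
        (hcont.intervalIntegrable _ _)]
      have : 0 ≤ C * (b - a) * (1 / 2) ^ (k + 1) * Real.exp (2 * K * (a - a)) := by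
        have : 0 ≤ b - a := sub_nonneg.2 (hs.1.trans hs.2)
        positivity
      linarith

theorem exists_isIntSol_tendsto_picardIter [CompleteSpace E] [MeasurableSpace W]
    {h : W → ℝ → E → E} {C : ℝ} {K : ℝ≥0}
    (hm : Measurable fun p : W × ℝ × E => h p.1 p.2.1 p.2.2) (hb : ∀ w r y, ‖h w r y‖ ≤ C)
    (hl : ∀ w r, LipschitzWith K (h w r)) (a b : ℝ) (x : E) (w : W) :
    ∃ X, IsIntSol (h w) a b x X ∧
      ∀ s ∈ Icc a b, Tendsto (fun k => picardIter h a x k w s) atTop (𝓝 (X s)) := by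
  have hcau : ∀ s ∈ Icc a b, ∃ y, Tendsto (fun k => picardIter h a x k w s) atTop (𝓝 y) := by
    intro s hs
    refine cauchySeq_tendsto_of_complete
      (cauchySeq_of_le_geometric (1 / 2) (C * (b - a) * Real.exp (2 * K * (s - a)))
        (by norm_num) fun k => ?_)
    rw [dist_comm, dist_eq_norm]
    refine (norm_picardIter_succ_sub_le hm hb hl x w k s hs).trans (le_of_eq ?_)
    ring
  choose! X hX using hcau
  have hmX : AEMeasurable X (volume.restrict (Icc a b)) :=
    aemeasurable_of_tendsto_metrizable_ae atTop
      (fun k => ((measurable_picardIter hm a x k).comp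
        (measurable_const.prodMk measurable_id)).aemeasurable)
      ((ae_restrict_iff' measurableSet_Icc).2 (Eventually.of_forall hX))
  have hI : IntegrableOn (fun r => h w r (X r)) (Icc a b) :=
    integrableOn_comp_of_bounded (h := h w) (hm.comp (measurable_const.prodMk measurable_id))
      (hb w) hmX
  have heq : ∀ s ∈ Icc a b, X s = x + ∫ r in a..s, h w r (X r) := by
    intro s hs
    refine tendsto_nhds_unique ((tendsto_add_atTop_iff_nat 1).2 (hX s hs)) ?_
    simp only [picardIter]
    refine tendsto_const_nhds.add
      (intervalIntegral.tendsto_integral_filter_of_dominated_convergence (fun _ => C) ?_ ?_ ?_ ?_)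
    · refine Eventually.of_forall fun k => Measurable.aestronglyMeasurable ?_
      exact hm.comp (measurable_const.prodMk (measurable_id.prodMk
        ((measurable_picardIter hm a x k).comp (measurable_const.prodMk measurable_id))))
    · exact Eventually.of_forall fun k => Eventually.of_forall fun r _ => hb _ _ _
    · exact intervalIntegrable_const
    · refine Eventually.of_forall fun r hr => ?_
      rw [uIoc_of_le hs.1] at hr
      exact ((hl w r).continuous.tendsto _).comp (hX r ⟨hr.1.le, hr.2.trans hs.2⟩)
  refine ⟨X, ⟨?_, heq⟩, hX⟩
  rcases lt_or_ge b a with hba | hab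
  · simp [Icc_eq_empty_of_lt hba]
  have hc := intervalIntegral.continuousOn_primitive_interval (μ := volume)
    ((uIcc_of_le hab).symm ▸ hI)
  rw [uIcc_of_le hab] at hc
  exact (continuousOn_const.add hc).congr heq

end IntegralEquation

/-! ### Essential suprema of directed families -/

section EssSup

variable {P : Measure Omega}

theorem IsEssSupFam.ae_eq {ι : Sort*} {ξ : ι → Omega → ℝ} {S S' : Omega → ℝ}
    (h : IsEssSupFam P ξ S) (h' : IsEssSupFam P ξ S') : S =ᵐ[P] S' :=
  (h.2 _ h'.1).antisymm (h'.2 _ h.1)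

theorem IsEssSupFam.congr {ι : Sort*} {ξ ξ' : ι → Omega → ℝ} {S : Omega → ℝ}
    (h : IsEssSupFam P ξ S) (he : ∀ i, ξ i =ᵐ[P] ξ' i) : IsEssSupFam P ξ' S :=
  ⟨fun i => (he i).symm.le.trans (h.1 i), fun W hW => h.2 W fun i => (he i).le.trans (hW i)⟩

theorem IsEssInfFam.ae_eq {ι : Sort*} {ξ : ι → Omega → ℝ} {S S' : Omega → ℝ}
    (h : IsEssInfFam P ξ S) (h' : IsEssInfFam P ξ S') : S =ᵐ[P] S' :=
  (h'.2 _ h.1).antisymm (h.2 _ h'.1)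

theorem IsEssInfFam.congr {ι : Sort*} {ξ ξ' : ι → Omega → ℝ} {S : Omega → ℝ}
    (h : IsEssInfFam P ξ S) (he : ∀ i, ξ i =ᵐ[P] ξ' i) : IsEssInfFam P ξ' S :=
  ⟨fun i => (h.1 i).trans (he i).le, fun W hW => h.2 W fun i => (hW i).trans (he i).symm.le⟩

theorem isEssSupFam_neg_iff {ι : Sort*} {ξ : ι → Omega → ℝ} {S : Omega → ℝ} :
    IsEssSupFam P (fun i => -ξ i) (-S) ↔ IsEssInfFam P ξ S := by
  have neg_le : ∀ X Y : Omega → ℝ, -X ≤ᵐ[P] -Y ↔ Y ≤ᵐ[P] X := fun X Y =>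
    ⟨fun h => h.mono fun ω hω => neg_le_neg_iff.1 hω, fun h => h.mono fun ω hω => neg_le_neg hω⟩
  constructor
  · rintro ⟨h1, h2⟩
    refine ⟨fun i => (neg_le _ _).1 (h1 i), fun W hW => (neg_le _ _).1 ?_⟩
    exact h2 (-W) fun i => (neg_le _ _).2 (hW i)
  · rintro ⟨h1, h2⟩
    refine ⟨fun i => (neg_le _ _).2 (h1 i), fun W hW => ?_⟩
    rw [← neg_neg W]
    refine (neg_le _ _).2 (h2 _ fun i => ?_)
    rw [← neg_le, neg_neg]
    exact hW i

/-- Random variables agreeing on a set of the conditioning σ-field have conditional expectations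
agreeing on this set. -/
theorem condExp_ae_eq_of_ae_eq_on {m : MeasurableSpace Omega} {A : Set Omega}
    (hA : MeasurableSet[m] A) {X Z : Omega → ℝ} (hX : Integrable X P) (hZ : Integrable Z P)
    (h : ∀ᵐ ω ∂P, ω ∈ A → Z ω = X ω) : ∀ᵐ ω ∂P, ω ∈ A → P[Z | m] ω = P[X | m] ω := by
  have e : A.indicator Z =ᵐ[P] A.indicator X := by
    filter_upwards [h] with ω hω
    by_cases hωA : ω ∈ A <;> simp [hωA, hω]
  filter_upwards [condExp_indicator hZ hA, condExp_indicator hX hA, condExp_congr_ae (m := m) e]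
    with ω h1 h2 h3 hωA
  rw [h1, h2] at h3
  simpa [hωA] using h3

variable [IsProbabilityMeasure P]

theorem abs_integral_le_of_ae {X : Omega → ℝ} {C : ℝ} (h : ∀ᵐ ω ∂P, |X ω| ≤ C) :
    |∫ ω, X ω ∂P| ≤ C := by
  simpa using norm_integral_le_of_norm_le_const (μ := P) (f := X) h

theorem exists_isEssSupFam_of_directed {ι : Type*} [Nonempty ι] {m : MeasurableSpace Omega}
    (hm : m ≤ MeasurableSpace.pi) {ξ : ι → Omega → ℝ} {C : ℝ}
    (hmeas : ∀ i, Measurable[m] (ξ i)) (hbdd : ∀ i, ∀ᵐ ω ∂P, |ξ i ω| ≤ C)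
    (hdir : ∀ i j, ∃ k, ξ i ≤ᵐ[P] ξ k ∧ ξ j ≤ᵐ[P] ξ k) :
    ∃ S : Omega → ℝ, Measurable[m] S ∧ (∀ᵐ ω ∂P, |S ω| ≤ C) ∧ IsEssSupFam P ξ S ∧
      ∫ ω, S ω ∂P = ⨆ i, ∫ ω, ξ i ω ∂P := by
  have hinteg : ∀ i, Integrable (ξ i) P := fun i =>
    Integrable.of_bound ((hmeas i).mono hm le_rfl).aestronglyMeasurable C (hbdd i)
  have hB : BddAbove (range fun i => ∫ ω, ξ i ω ∂P) := by
    refine ⟨C, ?_⟩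
    rintro _ ⟨i, rfl⟩
    exact (abs_le.1 (abs_integral_le_of_ae (hbdd i))).2
  set c := ⨆ i, ∫ ω, ξ i ω ∂P with hc
  obtain ⟨a, -, ha, hai⟩ := exists_seq_tendsto_sSup (range_nonempty fun i => ∫ ω, ξ i ω ∂P) hB
  choose i₀ hi₀ using hai
  choose up hup using hdir
  -- an almost surely increasing sequence of members along which the integrals converge to `c`
  let e : ℕ → ι := fun n => Nat.rec (i₀ 0) (fun n k => up k (i₀ (n + 1))) n
  have he : ∀ n, ξ (e n) ≤ᵐ[P] ξ (e (n + 1)) := fun n => (hup (e n) (i₀ (n + 1))).1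
  have he' : ∀ n, ξ (i₀ n) ≤ᵐ[P] ξ (e n)
    | 0 => EventuallyLE.refl _ _
    | n + 1 => (hup (e n) (i₀ (n + 1))).2
  have hlim : Tendsto (fun n => ∫ ω, ξ (e n) ω ∂P) atTop (𝓝 c) := by
    refine tendsto_of_tendsto_of_tendsto_of_le_of_le ha tendsto_const_nhds (fun n => ?_)
      fun n => le_ciSup hB (e n)
    rw [← hi₀ n]
    exact integral_mono_ae (hinteg _) (hinteg _) (he' n)
  let S : Omega → ℝ := fun ω => ⨆ n, ξ (e n) ω
  have hSm : Measurable[m] S := Measurable.iSup fun n => hmeas (e n)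
  have hall : ∀ᵐ ω ∂P, (∀ n, |ξ (e n) ω| ≤ C) ∧ ∀ n, ξ (e n) ω ≤ ξ (e (n + 1)) ω :=
    (ae_all_iff.2 fun n => hbdd (e n)).and (ae_all_iff.2 he)
  have hbS : ∀ {ω}, (∀ n, |ξ (e n) ω| ≤ C) → BddAbove (range fun n => ξ (e n) ω) := by
    intro ω h
    refine ⟨C, ?_⟩
    rintro _ ⟨n, rfl⟩
    exact (abs_le.1 (h n)).2
  have hSC : ∀ᵐ ω ∂P, |S ω| ≤ C := by
    filter_upwards [hall] with ω hω
    exact abs_le.2 ⟨(abs_le.1 (hω.1 0)).1.trans (le_ciSup (hbS hω.1) 0),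
      ciSup_le fun n => (abs_le.1 (hω.1 n)).2⟩
  have hSi : Integrable S P :=
    Integrable.of_bound (hSm.mono hm le_rfl).aestronglyMeasurable C hSC
  have hSint : ∫ ω, S ω ∂P = c := by
    refine tendsto_nhds_unique (tendsto_integral_of_dominated_convergence (fun _ => C)
      (fun n => (hinteg (e n)).1) (integrable_const C) (fun n => hbdd (e n)) ?_) hlim
    filter_upwards [hall] with ω hω
    exact tendsto_atTop_ciSup (monotone_nat_of_le_succ hω.2) (hbS hω.1)
  refine ⟨S, hSm, hSC, ⟨fun j => ?_, fun Z hZ => ?_⟩, hSint⟩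
  · -- the integral of `max S (ξ j)` does not exceed that of `S`
    have hmax : Integrable (fun ω => max (S ω) (ξ j ω)) P := hSi.sup (hinteg j)
    have hle : ∫ ω, max (S ω) (ξ j ω) ∂P ≤ c := by
      have hl : Tendsto (fun n => ∫ ω, max (ξ (e n) ω) (ξ j ω) ∂P) atTop
          (𝓝 (∫ ω, max (S ω) (ξ j ω) ∂P)) := by
        refine tendsto_integral_of_dominated_convergence (fun _ => C)
          (fun n => ((hinteg (e n)).sup (hinteg j)).1) (integrable_const C) (fun n => ?_) ?_
        · filter_upwards [hbdd (e n), hbdd j] with ω h1 h2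
          exact abs_max_le_max_abs_abs.trans (max_le h1 h2)
        · filter_upwards [hall] with ω hω
          exact (tendsto_atTop_ciSup (monotone_nat_of_le_succ hω.2) (hbS hω.1)).max
            tendsto_const_nhds
      refine le_of_tendsto' hl fun n => ?_
      refine le_trans (integral_mono_ae ((hinteg (e n)).sup (hinteg j)) (hinteg (up (e n) j)) ?_)
        (le_ciSup hB (up (e n) j))
      filter_upwards [(hup (e n) j).1, (hup (e n) j).2] with ω h1 h2 using max_le h1 h2
    have h0 : ∫ ω, (max (S ω) (ξ j ω) - S ω) ∂P = 0 := by
      refine le_antisymm ?_ (integral_nonneg fun ω => sub_nonneg.2 (le_max_left _ _))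
      rw [integral_sub hmax hSi, hSint]
      linarith
    rw [integral_eq_zero_iff_of_nonneg (fun ω => sub_nonneg.2 (le_max_left _ _))
      (hmax.sub hSi)] at h0
    filter_upwards [h0] with ω hω
    have : max (S ω) (ξ j ω) - S ω = 0 := hω
    linarith [le_max_right (S ω) (ξ j ω)]
  · filter_upwards [ae_all_iff.2 fun n => hZ (e n)] with ω hω using ciSup_le hω

theorem exists_isEssInfFam_of_directed {ι : Type*} [Nonempty ι] {m : MeasurableSpace Omega}
    (hm : m ≤ MeasurableSpace.pi) {ξ : ι → Omega → ℝ} {C : ℝ}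
    (hmeas : ∀ i, Measurable[m] (ξ i)) (hbdd : ∀ i, ∀ᵐ ω ∂P, |ξ i ω| ≤ C)
    (hdir : ∀ i j, ∃ k, ξ k ≤ᵐ[P] ξ i ∧ ξ k ≤ᵐ[P] ξ j) :
    ∃ S : Omega → ℝ, Measurable[m] S ∧ (∀ᵐ ω ∂P, |S ω| ≤ C) ∧ IsEssInfFam P ξ S ∧
      ∫ ω, S ω ∂P = ⨅ i, ∫ ω, ξ i ω ∂P := by
  obtain ⟨S, h1, h2, h3, h4⟩ := exists_isEssSupFam_of_directed (P := P) hm (ξ := fun i => -ξ i)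
    (C := C) (fun i => (hmeas i).neg) (fun i => by simpa using hbdd i) (fun i j => by
      obtain ⟨k, hi, hj⟩ := hdir i j
      exact ⟨k, hi.mono fun ω => neg_le_neg, hj.mono fun ω => neg_le_neg⟩)
  refine ⟨-S, h1.neg, by simpa using h2, ?_, ?_⟩
  · rw [← isEssSupFam_neg_iff, neg_neg]
    exact h3
  · simp only [Pi.neg_apply, integral_neg, h4, iSup, iInf, Real.sInf_def]
    congr 2
    ext y
    simp [neg_eq_iff_eq_neg]

section SupInf

variable {ι κ : Type*} [Nonempty ι] [Nonempty κ] {m : MeasurableSpace Omega}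
  {p : ι → κ → Omega → ℝ} {C : ℝ}

/-- If the families can be pasted along sets of `m`, then the expectation of the essential
supremum over `ι` of the essential infimum over `κ` of the conditional expectations given `m`
exists and is the supremum of the infimum of the expectations. -/
theorem exists_essSup_essInf_condExp (hm : m ≤ MeasurableSpace.pi)
    (hinteg : ∀ i k, Integrable (p i k) P) (hbdd : ∀ i k ω, |p i k ω| ≤ C)
    (hι : ∀ i₁ i₂ A, MeasurableSet[m] A → ∃ i, ∀ k,
      (∀ᵐ ω ∂P, ω ∈ A → p i k ω = p i₁ k ω) ∧ ∀ᵐ ω ∂P, ω ∈ Aᶜ → p i k ω = p i₂ k ω)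
    (hκ : ∀ k₁ k₂ A, MeasurableSet[m] A → ∃ k, ∀ i,
      (∀ᵐ ω ∂P, ω ∈ A → p i k ω = p i k₁ ω) ∧ ∀ᵐ ω ∂P, ω ∈ Aᶜ → p i k ω = p i k₂ ω) :
    ∃ (J : ι → Omega → ℝ) (S : Omega → ℝ),
      (∀ i, IsEssInfFam P (fun k => P[p i k | m]) (J i)) ∧ IsEssSupFam P J S ∧
      ∫ ω, S ω ∂P = ⨆ i, ⨅ k, ∫ ω, p i k ω ∂P := by
  have hmeas : ∀ i k, Measurable[m] (P[p i k | m]) := fun i k =>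
    stronglyMeasurable_condExp.measurable
  have hb : ∀ i k, ∀ᵐ ω ∂P, |(P[p i k | m]) ω| ≤ C := fun i k =>
    ae_bdd_abs_condExp_of_ae_bdd_abs (Eventually.of_forall (hbdd i k))
  have hJ : ∀ i, ∃ J : Omega → ℝ, Measurable[m] J ∧ (∀ᵐ ω ∂P, |J ω| ≤ C) ∧
      IsEssInfFam P (fun k => P[p i k | m]) J ∧ ∫ ω, J ω ∂P = ⨅ k, ∫ ω, (P[p i k | m]) ω ∂P := by
    refine fun i => exists_isEssInfFam_of_directed hm (hmeas i) (hb i) fun k₁ k₂ => ?_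
    set A : Set Omega := {ω | (P[p i k₁ | m]) ω ≤ (P[p i k₂ | m]) ω}
    have hA : MeasurableSet[m] A := measurableSet_le (hmeas i k₁) (hmeas i k₂)
    obtain ⟨k, hk⟩ := hκ k₁ k₂ A hA
    refine ⟨k, ?_⟩
    have e₁ := condExp_ae_eq_of_ae_eq_on hA (hinteg i k₁) (hinteg i k) (hk i).1
    have e₂ := condExp_ae_eq_of_ae_eq_on hA.compl (hinteg i k₂) (hinteg i k) (hk i).2
    constructor <;> filter_upwards [e₁, e₂] with ω h₁ h₂ <;> by_cases hω : ω ∈ A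
    · exact (h₁ hω).le
    · exact (h₂ hω).le.trans (not_le.1 hω).le
    · exact (h₁ hω).le.trans hω
    · exact (h₂ hω).le
  choose J hJm hJb hJinf hJint using hJ
  obtain ⟨S, -, -, hS, hSint⟩ := exists_isEssSupFam_of_directed (P := P) hm hJm hJb
    fun i₁ i₂ => by
      set A : Set Omega := {ω | J i₂ ω ≤ J i₁ ω}
      have hA : MeasurableSet[m] A := measurableSet_le (hJm i₂) (hJm i₁)
      obtain ⟨i, hi⟩ := hι i₁ i₂ A hA
      have hmax : (fun ω => max (J i₁ ω) (J i₂ ω)) ≤ᵐ[P] J i := by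
        refine (hJinf i).2 _ fun k => ?_
        filter_upwards [condExp_ae_eq_of_ae_eq_on hA (hinteg i₁ k) (hinteg i k) (hi k).1,
          condExp_ae_eq_of_ae_eq_on hA.compl (hinteg i₂ k) (hinteg i k) (hi k).2,
          (hJinf i₁).1 k, (hJinf i₂).1 k] with ω h₁ h₂ h₃ h₄
        by_cases hω : ω ∈ A
        · rw [h₁ hω, max_eq_left hω]
          exact h₃
        · rw [h₂ hω, max_eq_right (not_le.1 hω).le]
          exact h₄
      exact ⟨i, hmax.mono fun ω h => (le_max_left _ _).trans h,
        hmax.mono fun ω h => (le_max_right _ _).trans h⟩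
  refine ⟨J, S, hJinf, hS, ?_⟩
  simp_rw [hSint, hJint, integral_condExp hm]

end SupInf

end EssSup

/-! ### Partitions and the discrete filtration -/

theorem Fsig_le (j : ℕ) : Fsig j ≤ MeasurableSpace.pi :=
  Measurable.comap_le (measurable_pi_lambda _ fun _ => measurable_pi_apply _)

theorem Fsig_mono {i j : ℕ} (h : i ≤ j) : Fsig i ≤ Fsig j := by
  have e : (fun (ω : Omega) (l : Fin i) => ω (l : ℕ))
      = (fun (y : Fin j → I × I) (l : Fin i) => y (Fin.castLE h l)) ∘
        fun (ω : Omega) (l : Fin j) => ω (l : ℕ) := rfl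
  unfold Fsig
  rw [e, ← MeasurableSpace.comap_comp]
  exact MeasurableSpace.comap_mono
    (Measurable.comap_le (measurable_pi_lambda _ fun _ => measurable_pi_apply _))

namespace Partition

variable {T : ℝ} (π : Partition T)

theorem idx_lt (s : ℝ) : π.idx s < π.n :=
  lt_of_le_of_lt (Nat.findGreatest_le _) (Nat.sub_lt π.npos one_pos)

theorem t_idx_le {s : ℝ} (hs : 0 ≤ s) : π.t (π.idx s) ≤ s := by
  classical
  have := Nat.findGreatest_spec (P := fun i => π.t i ≤ s) (m := 0) (n := π.n - 1) (Nat.zero_le _)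
    (by rw [π.map_zero]; exact hs)
  unfold idx
  convert this

theorem t_le_t {i j : ℕ} (hij : i ≤ j) (hj : j ≤ π.n) : π.t i ≤ π.t j := by
  induction j, hij using Nat.le_induction with
  | base => exact le_rfl
  | succ j _ ih => exact (ih (Nat.le_of_succ_le hj)).trans (π.mono j hj).le

theorem t_le_last {i : ℕ} (hi : i ≤ π.n) : π.t i ≤ T :=
  (π.t_le_t hi le_rfl).trans_eq π.map_last

end Partition

/-! ### Admissible controls and strategies with unspecified roles of the players -/

section Controls

variable {A B : Type} [MeasurableSpace A] [MeasurableSpace B] {G H : ℕ → MeasurableSpace Omega}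
  {T : ℝ} {P : Measure Omega} {π : Partition T}

/-- Admissible controls of a player with private information `G`. -/
def AdmControl (G : ℕ → MeasurableSpace Omega) (A : Type) [MeasurableSpace A] {T : ℝ}
    (π : Partition T) : Set (ℝ → Omega → A) :=
  {u | Measurable (Function.uncurry u) ∧
    ∀ j < π.n, ∃ (Γ : ℕ → Set Omega) (w : ℕ → ℝ → Omega → A),
      (∀ k, MeasurableSet[Fsig j] (Γ k)) ∧
      Pairwise (Function.onFun Disjoint Γ) ∧
      (⋃ k, Γ k) = univ ∧
      (∀ k s, Measurable[G j] (w k s)) ∧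
      (∀ k, ∀ ω ∈ Γ k, ∀ s ∈ Ico (π.t j) (π.t (j + 1)), u s ω = w k s ω)}

/-- NAD strategies on `[t,T]` of a player with private information `G` against a player with
private information `H`. -/
def IsNAD (G H : ℕ → MeasurableSpace Omega) {T : ℝ} (P : Measure Omega) (π : Partition T) (t : ℝ)
    (α : (ℝ → Omega → B) → (ℝ → Omega → A)) : Prop :=
  (∀ v ∈ AdmControl H B π, α v ∈ AdmControl G A π) ∧
  ∀ τ : Omega → ℕ, IsStoppingIdx π τ →
    ∀ v w, v ∈ AdmControl H B π → w ∈ AdmControl H B π →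
      aeStEq P t (fun ω => π.t (τ ω)) v w →
      aeStEq P t (fun ω => π.t (τ ω + 1)) (α v) (α w)

/-- `(u,v)` is a couple of admissible controls associated with `(α,β)` on `[t,T]`. -/
def IsFix (G H : ℕ → MeasurableSpace Omega) {T : ℝ} (P : Measure Omega) (π : Partition T) (t : ℝ)
    (α : (ℝ → Omega → B) → (ℝ → Omega → A)) (β : (ℝ → Omega → A) → (ℝ → Omega → B))
    (u : ℝ → Omega → A) (v : ℝ → Omega → B) : Prop :=
  u ∈ AdmControl G A π ∧ v ∈ AdmControl H B π ∧ aeEqIcc P t T (α v) u ∧ aeEqIcc P t T (β u) v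

/-- `u = u'`, `ds⊗dP`-a.e. on `[a,b] × S`. -/
def AeEqOn {E : Type*} (P : Measure Omega) (S : Set Omega) (a b : ℝ)
    (u u' : ℝ → Omega → E) : Prop :=
  ∀ᵐ p ∂((volume : Measure ℝ).prod P), p.2 ∈ S → p.1 ∈ Icc a b → u p.1 p.2 = u' p.1 p.2

theorem aeEqOn_univ_iff {E : Type*} {a b : ℝ} {u u' : ℝ → Omega → E} :
    AeEqOn P univ a b u u' ↔ aeEqIcc P a b u u' := by
  simp [AeEqOn, aeEqIcc]

namespace AeEqOn

variable {E : Type*} {S S' : Set Omega} {a b a' b' : ℝ} {u u' u'' : ℝ → Omega → E}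

theorem refl : AeEqOn P S a b u u := Eventually.of_forall fun _ _ _ => rfl

theorem symm (h : AeEqOn P S a b u u') : AeEqOn P S a b u' u :=
  h.mono fun _ hp h1 h2 => (hp h1 h2).symm

theorem trans (h : AeEqOn P S a b u u') (h' : AeEqOn P S a b u' u'') : AeEqOn P S a b u u'' := by
  filter_upwards [h, h'] with p h1 h2 h3 h4 using (h1 h3 h4).trans (h2 h3 h4)

theorem mono (h : AeEqOn P S a b u u') (hS : S' ⊆ S) (ha : a ≤ a') (hb : b' ≤ b) :
    AeEqOn P S' a' b' u u' :=
  Eventually.mono h fun _ hp h1 h2 => hp (hS h1) ⟨ha.trans h2.1, h2.2.trans hb⟩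

end AeEqOn

theorem ae_prod_fst_ne [SFinite P] (a : ℝ) :
    ∀ᵐ p ∂((volume : Measure ℝ).prod P), p.1 ≠ a :=
  Measure.quasiMeasurePreserving_fst.ae (p := fun s : ℝ => s ≠ a) (Measure.ae_ne volume a)

theorem aeEqOn_of_le [SFinite P] {E : Type*} {S : Set Omega} {a b : ℝ} (hab : b ≤ a)
    (u u' : ℝ → Omega → E) : AeEqOn P S a b u u' := by
  filter_upwards [ae_prod_fst_ne a] with p hp _ h
  exact absurd (le_antisymm (h.2.trans hab) h.1) hp

theorem IsNAD.aeEqOn_succ [SFinite P] {t : ℝ} (ht : 0 ≤ t)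
    {α : (ℝ → Omega → B) → (ℝ → Omega → A)} (hα : IsNAD G H P π t α) {S : Set Omega}
    (hS : MeasurableSet[Fsig (π.idx t)] S) {k : ℕ} (hk : k < π.n) {v v' : ℝ → Omega → B}
    (hv : v ∈ AdmControl H B π) (hv' : v' ∈ AdmControl H B π) (h : AeEqOn P S t (π.t k) v v') :
    AeEqOn P S t (π.t (k + 1)) (α v) (α v') := by
  classical
  rcases lt_or_ge k (π.idx t) with hki | hki
  · exact aeEqOn_of_le ((π.t_le_t hki (π.idx_lt t).le).trans (π.t_idx_le ht)) _ _
  have hτ : IsStoppingIdx π fun ω => if ω ∈ S then k else π.idx t := by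
    refine ⟨fun ω => ?_, fun j => ?_⟩
    · dsimp only
      split_ifs
      exacts [hk, π.idx_lt t]
    · by_cases hj : π.idx t ≤ j
      · have hSj : MeasurableSet[Fsig j] S := Fsig_mono hj _ hS
        have : {ω | (if ω ∈ S then k else π.idx t) = j}
            = (S ∩ {_ω | k = j}) ∪ (Sᶜ ∩ {_ω | π.idx t = j}) := by
          ext ω
          by_cases hω : ω ∈ S <;> simp [hω]
        rw [this]
        exact (hSj.inter (MeasurableSet.const _)).union (hSj.compl.inter (MeasurableSet.const _))
      · have : {ω | (if ω ∈ S then k else π.idx t) = j} = ∅ := by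
          ext ω
          simp only [mem_ofPred_eq, mem_empty_iff_false, iff_false]
          split_ifs <;> omega
        rw [this]
        exact @MeasurableSet.empty _ (Fsig j)
  have key := hα.2 _ hτ v v' hv hv' (by
    filter_upwards [h, ae_prod_fst_ne t] with p h1 h2 h3 h4
    by_cases hp : p.2 ∈ S
    · rw [if_pos hp] at h4
      exact h1 hp ⟨h3, h4⟩
    · rw [if_neg hp] at h4
      exact absurd (le_antisymm (h4.trans (π.t_idx_le ht)) h3) h2)
  filter_upwards [key] with p hp hpS hpI
  refine hp hpI.1 ?_
  rw [if_pos hpS]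
  exact hpI.2

theorem IsNAD.aeEqOn [SFinite P] {t : ℝ} (ht : 0 ≤ t)
    {α : (ℝ → Omega → B) → (ℝ → Omega → A)} (hα : IsNAD G H P π t α) {S : Set Omega}
    (hS : MeasurableSet[Fsig (π.idx t)] S) {v v' : ℝ → Omega → B}
    (hv : v ∈ AdmControl H B π) (hv' : v' ∈ AdmControl H B π) (h : AeEqOn P S t T v v') :
    AeEqOn P S t T (α v) (α v') := by
  have hn := Nat.sub_add_cancel (Nat.one_le_iff_ne_zero.2 π.npos.ne')
  have hT : π.t (π.n - 1 + 1) = T := by rw [hn, π.map_last]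
  have := hα.aeEqOn_succ ht hS (Nat.sub_lt π.npos one_pos) hv hv' (h.mono subset_rfl le_rfl
    (π.t_le_last (Nat.sub_le _ _)))
  rwa [hT] at this

theorem IsFix.aeEqOn [SFinite P] {t : ℝ} (ht : 0 ≤ t) {S : Set Omega}
    (hS : MeasurableSet[Fsig (π.idx t)] S)
    {α α' : (ℝ → Omega → B) → (ℝ → Omega → A)} {β β' : (ℝ → Omega → A) → (ℝ → Omega → B)}
    (hα : IsNAD G H P π t α) (hβ : IsNAD H G P π t β)
    (hαα' : ∀ v ∈ AdmControl H B π, AeEqOn P S t T (α v) (α' v))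
    (hββ' : ∀ u ∈ AdmControl G A π, AeEqOn P S t T (β u) (β' u))
    {u u' : ℝ → Omega → A} {v v' : ℝ → Omega → B}
    (h : IsFix G H P π t α β u v) (h' : IsFix G H P π t α' β' u' v') :
    AeEqOn P S t T u u' ∧ AeEqOn P S t T v v' := by
  obtain ⟨hu, hv, h1, h2⟩ := h
  obtain ⟨hu', hv', h1', h2'⟩ := h'
  rw [← aeEqOn_univ_iff] at h1 h2 h1' h2'
  have key : ∀ k ≤ π.n, AeEqOn P S t (π.t k) u u' ∧ AeEqOn P S t (π.t k) v v' := by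
    intro k
    induction k with
    | zero =>
      intro _
      rw [π.map_zero]
      exact ⟨aeEqOn_of_le ht _ _, aeEqOn_of_le ht _ _⟩
    | succ k ih =>
      intro hk
      obtain ⟨ihu, ihv⟩ := ih (Nat.le_of_succ_le hk)
      have hT : π.t (k + 1) ≤ T := π.t_le_last hk
      exact ⟨(h1.symm.mono (subset_univ _) le_rfl hT).trans
          ((hα.aeEqOn_succ ht hS hk hv hv' ihv).trans
            (((hαα' v' hv').mono subset_rfl le_rfl hT).trans
              (h1'.mono (subset_univ _) le_rfl hT))),
        (h2.symm.mono (subset_univ _) le_rfl hT).trans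
          ((hβ.aeEqOn_succ ht hS hk hu hu' ihu).trans
            (((hββ' u' hu').mono subset_rfl le_rfl hT).trans
              (h2'.mono (subset_univ _) le_rfl hT)))⟩
  simpa [π.map_last] using key π.n le_rfl

theorem const_mem_admControl (c : A) : (fun _ _ => c) ∈ AdmControl G A π := by
  refine ⟨measurable_const, fun j _ => ⟨fun k => if k = 0 then univ else ∅, fun _ _ _ => c,
    fun k => ?_, fun k l hkl => ?_, ?_, fun _ _ => measurable_const, fun _ _ _ _ _ => rfl⟩⟩
  · dsimp only
    split_ifs
    exacts [MeasurableSet.univ, @MeasurableSet.empty _ (Fsig j)]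
  · rcases Nat.eq_zero_or_pos k with rfl | hk
    · simp [Function.onFun, hkl.symm]
    · simp [Function.onFun, hk.ne']
  · exact eq_univ_of_forall fun ω => mem_iUnion.2 ⟨0, by simp⟩

theorem isNAD_const {t : ℝ} (c : A) :
    IsNAD G H P π t (fun (_ : ℝ → Omega → B) _ _ => c) :=
  ⟨fun _ _ => const_mem_admControl c, fun _ _ _ _ _ _ _ => Eventually.of_forall fun _ _ _ => rfl⟩

theorem exists_isFix [SFinite P] [Nonempty A] [Nonempty B] {t : ℝ} (ht : 0 ≤ t)
    {α : (ℝ → Omega → B) → (ℝ → Omega → A)} {β : (ℝ → Omega → A) → (ℝ → Omega → B)}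
    (hα : IsNAD G H P π t α) (hβ : IsNAD H G P π t β) :
    ∃ u v, IsFix G H P π t α β u v := by
  let it : ℕ → (ℝ → Omega → A) × (ℝ → Omega → B) := fun k =>
    (fun p => (α p.2, β p.1))^[k] (fun _ _ => Classical.arbitrary A, fun _ _ => Classical.arbitrary B)
  have it_succ : ∀ k, it (k + 1) = (α (it k).2, β (it k).1) := fun k =>
    Function.iterate_succ_apply' _ _ _
  have hadm : ∀ k, (it k).1 ∈ AdmControl G A π ∧ (it k).2 ∈ AdmControl H B π := by
    intro k
    induction k with
    | zero => exact ⟨const_mem_admControl _, const_mem_admControl _⟩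
    | succ k ih =>
      rw [it_succ]
      exact ⟨hα.1 _ ih.2, hβ.1 _ ih.1⟩
  have key : ∀ k ≤ π.n, AeEqOn P univ t (π.t k) (it (k + 1)).1 (it k).1 ∧
      AeEqOn P univ t (π.t k) (it (k + 1)).2 (it k).2 := by
    intro k
    induction k with
    | zero =>
      intro _
      rw [π.map_zero]
      exact ⟨aeEqOn_of_le ht _ _, aeEqOn_of_le ht _ _⟩
    | succ k ih =>
      intro hk
      obtain ⟨ihu, ihv⟩ := ih (Nat.le_of_succ_le hk)
      rw [it_succ (k + 1)]
      have e := it_succ k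
      constructor
      · have := hα.aeEqOn_succ ht MeasurableSet.univ hk (hadm (k + 1)).2 (hadm k).2 ihv
        rwa [show α (it k).2 = (it (k + 1)).1 by rw [e]] at this
      · have := hβ.aeEqOn_succ ht MeasurableSet.univ hk (hadm (k + 1)).1 (hadm k).1 ihu
        rwa [show β (it k).1 = (it (k + 1)).2 by rw [e]] at this
  obtain ⟨h1, h2⟩ := key π.n le_rfl
  rw [it_succ, π.map_last, aeEqOn_univ_iff] at h1 h2
  exact ⟨_, _, (hadm π.n).1, (hadm π.n).2, h1, h2⟩

open scoped Classical in
/-- The control equal to the constant `c` before time `t`, and from time `t` on to `u` on `S` and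
to `u'` on the complement of `S`. -/
def pasteCtrl (t : ℝ) (c : A) (S : Set Omega) (u u' : ℝ → Omega → A) : ℝ → Omega → A :=
  fun s ω => if s < t then c else if ω ∈ S then u s ω else u' s ω

theorem pasteCtrl_mem {t : ℝ} (ht : 0 ≤ t) (c : A) {S : Set Omega}
    (hS : MeasurableSet[Fsig (π.idx t)] S) {u u' : ℝ → Omega → A} (hu : u ∈ AdmControl G A π)
    (hu' : u' ∈ AdmControl G A π) : pasteCtrl t c S u u' ∈ AdmControl G A π := by
  classical
  refine ⟨?_, fun j hj => ?_⟩
  · refine Measurable.ite (measurableSet_lt measurable_fst measurable_const) measurable_const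
      (Measurable.ite ?_ hu.1 hu'.1)
    exact measurable_snd (Fsig_le _ _ hS)
  obtain ⟨Γ, w, h1, h2, h3, h4, h5⟩ := hu.2 j hj
  obtain ⟨Γ', w', h1', h2', h3', h4', h5'⟩ := hu'.2 j hj
  rcases lt_or_ge j (π.idx t) with hji | hji
  · refine ⟨Γ, fun _ _ _ => c, h1, h2, h3, fun _ _ => measurable_const, fun k ω _ s hs => ?_⟩
    exact if_pos (hs.2.trans_le ((π.t_le_t hji (π.idx_lt t).le).trans (π.t_idx_le ht)))
  have hSj : MeasurableSet[Fsig j] S := Fsig_mono hji _ hS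
  let e : ℕ ≃ ℕ ⊕ ℕ := Equiv.natSumNatEquivNat.symm
  let Δ : ℕ ⊕ ℕ → Set Omega := Sum.elim (fun k => Γ k ∩ S) (fun k => Γ' k ∩ Sᶜ)
  have hΔ : Pairwise (Function.onFun Disjoint Δ) := by
    rintro (k | k) (l | l) hkl
    · exact (h2 (by simpa using hkl)).mono inter_subset_left inter_subset_left
    · exact disjoint_compl_right.mono inter_subset_right inter_subset_right
    · exact disjoint_compl_left.mono inter_subset_right inter_subset_right
    · exact (h2' (by simpa using hkl)).mono inter_subset_left inter_subset_left
  refine ⟨Δ ∘ e, fun k s => if s < t then fun _ => c else Sum.elim w w' (e k) s, fun k => ?_,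
    fun k l hkl => hΔ (e.injective.ne hkl), ?_, fun k s => ?_, fun k ω hω s hs => ?_⟩
  · simp only [Function.comp_apply]
    rcases e k with l | l
    · exact (h1 l).inter hSj
    · exact (h1' l).inter hSj.compl
  · refine eq_univ_of_forall fun ω => ?_
    by_cases hω : ω ∈ S
    · obtain ⟨k, hk⟩ := mem_iUnion.1 (h3.symm ▸ mem_univ ω : ω ∈ ⋃ k, Γ k)
      exact mem_iUnion.2 ⟨e.symm (.inl k), by simpa [Δ] using ⟨hk, hω⟩⟩
    · obtain ⟨k, hk⟩ := mem_iUnion.1 (h3'.symm ▸ mem_univ ω : ω ∈ ⋃ k, Γ' k)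
      exact mem_iUnion.2 ⟨e.symm (.inr k), by simpa [Δ] using ⟨hk, hω⟩⟩
  · dsimp only
    split_ifs
    · exact measurable_const
    · rcases e k with l | l
      · exact h4 l s
      · exact h4' l s
  · replace hω : ω ∈ Δ (e k) := hω
    simp only [pasteCtrl]
    generalize e k = l at hω ⊢
    rcases l with l | l
    · obtain ⟨hω, hωS⟩ : ω ∈ Γ l ∩ S := hω
      split_ifs
      exacts [rfl, h5 l ω hω s hs]
    · obtain ⟨hω, hωS⟩ : ω ∈ Γ' l ∩ Sᶜ := hω
      rw [if_neg hωS]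
      split_ifs
      exacts [rfl, h5' l ω hω s hs]

theorem IsNAD.paste {t t' : ℝ} (ht : 0 ≤ t) (htt' : t ≤ t') (c : A) {S : Set Omega}
    (hS : MeasurableSet[Fsig (π.idx t')] S) {α α' : (ℝ → Omega → B) → (ℝ → Omega → A)}
    (hα : IsNAD G H P π t' α) (hα' : IsNAD G H P π t' α') :
    IsNAD G H P π t fun v => pasteCtrl t' c S (α v) (α' v) := by
  refine ⟨fun v hv => pasteCtrl_mem (ht.trans htt') c hS (hα.1 v hv) (hα'.1 v hv),
    fun τ hτ v v' hv hv' h => ?_⟩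
  have h' : aeStEq P t' (fun ω => π.t (τ ω)) v v' := h.mono fun p hp h1 => hp (htt'.trans h1)
  filter_upwards [hα.2 τ hτ v v' hv hv' h', hα'.2 τ hτ v v' hv hv' h'] with p h1 h2 _ h4
  rcases lt_or_ge p.1 t' with hp | hp
  · simp [pasteCtrl, hp]
  · simp [pasteCtrl, h1 hp h4, h2 hp h4]

theorem IsNAD.comp_paste {t t' : ℝ} (ht : 0 ≤ t) (htt' : t ≤ t') (c : B)
    {α : (ℝ → Omega → B) → (ℝ → Omega → A)} (hα : IsNAD G H P π t α) :
    IsNAD G H P π t' fun v => α (pasteCtrl t' c univ v v) := by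
  have hp : ∀ v ∈ AdmControl H B π, pasteCtrl t' c univ v v ∈ AdmControl H B π := fun v hv =>
    pasteCtrl_mem (ht.trans htt') c MeasurableSet.univ hv hv
  refine ⟨fun v hv => hα.1 _ (hp v hv), fun τ hτ v v' hv hv' h => ?_⟩
  refine (hα.2 τ hτ _ _ (hp v hv) (hp v' hv') ?_).mono fun p hp h1 => hp (htt'.trans h1)
  filter_upwards [h] with p h1 _ h3
  rcases lt_or_ge p.1 t' with hp | hp
  · simp [pasteCtrl, hp]
  · simp [pasteCtrl, h1 hp h3]

theorem IsFix.of_paste [SFinite P] {t t' : ℝ} (ht : 0 ≤ t) (htt' : t ≤ t') (c : B)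
    {α : (ℝ → Omega → B) → (ℝ → Omega → A)} {β : (ℝ → Omega → A) → (ℝ → Omega → B)}
    (hα : IsNAD G H P π t α) {u : ℝ → Omega → A} {v : ℝ → Omega → B}
    (h : IsFix G H P π t α (fun u => pasteCtrl t' c univ (β u) (β u)) u v) :
    IsFix G H P π t' (fun v => α (pasteCtrl t' c univ v v)) β u v := by
  obtain ⟨hu, hv, h1, h2⟩ := h
  refine ⟨hu, hv, ?_, ?_⟩
  · have e : AeEqOn P univ t T (pasteCtrl t' c univ v v) v := by
      filter_upwards [h2] with p hp _ hpI
      rcases lt_or_ge p.1 t' with hpt | hpt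
      · simpa [pasteCtrl, hpt] using hp hpI
      · simp [pasteCtrl, hpt.not_gt]
    rw [← aeEqOn_univ_iff] at h1 ⊢
    exact ((hα.aeEqOn ht MeasurableSet.univ (pasteCtrl_mem (ht.trans htt') c MeasurableSet.univ
      hv hv) hv e).trans h1).mono subset_rfl htt' le_rfl
  · filter_upwards [h2] with p hp hpI
    simpa [pasteCtrl, hpI.1.not_gt] using hp ⟨htt'.trans hpI.1, hpI.2⟩

theorem IsFix.swap {t : ℝ} {α : (ℝ → Omega → B) → (ℝ → Omega → A)}
    {β : (ℝ → Omega → A) → (ℝ → Omega → B)} {u : ℝ → Omega → A} {v : ℝ → Omega → B}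
    (h : IsFix G H P π t α β u v) : IsFix H G P π t β α v u :=
  ⟨h.2.1, h.1, h.2.2.2, h.2.2.1⟩

end Controls

/-! ### Regularity of the pay-off -/

section Game

variable {d : ℕ} {A B : Type}
  {f f' : ℝ → EuclideanSpace ℝ (Fin d) → A → B → EuclideanSpace ℝ (Fin d)}
  {g : EuclideanSpace ℝ (Fin d) → ℝ} {C D : ℝ} {K L : ℝ≥0} {T : ℝ}

theorem sol_congr (h : ∀ t ∈ Icc 0 T, f t = f' t) {t : ℝ} (ht : 0 ≤ t)
    (x : EuclideanSpace ℝ (Fin d)) (u : ℝ → A) (v : ℝ → B) :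
    sol f T t x u v = sol f' T t x u v := by
  have : IsSol f T t x u v = IsSol f' T t x u v := by
    funext X
    refine propext (and_congr_right fun _ => forall₂_congr fun s hs => ?_)
    rw [intervalIntegral.integral_congr (g := fun r => f' r (X r) (u r) (v r))]
    intro r hr
    rw [uIcc_of_le hs.1] at hr
    simp only [h r ⟨ht.trans hr.1, hr.2.trans hs.2⟩]
  simp only [sol, this]

variable [MeasurableSpace A] [MeasurableSpace B]

/-- Quantitative standing assumptions on the dynamics `f` and the terminal pay-off `g`. -/
structure IsRegular (f : ℝ → EuclideanSpace ℝ (Fin d) → A → B → EuclideanSpace ℝ (Fin d))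
    (g : EuclideanSpace ℝ (Fin d) → ℝ) (C D : ℝ) (K L : ℝ≥0) : Prop where
  measurable : Measurable
    fun q : ℝ × EuclideanSpace ℝ (Fin d) × A × B => f q.1 q.2.1 q.2.2.1 q.2.2.2
  bound : ∀ t x u v, ‖f t x u v‖ ≤ C
  lipschitz : ∀ t u v, LipschitzWith K fun x => f t x u v
  payoff_bound : ∀ x, |g x| ≤ D
  payoff_lipschitz : LipschitzWith L g

namespace IsRegular

theorem measurable_param (hR : IsRegular f g C D K L) {u : ℝ → Omega → A} {v : ℝ → Omega → B}
    (hu : Measurable (Function.uncurry u)) (hv : Measurable (Function.uncurry v)) :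
    Measurable fun p : Omega × ℝ × EuclideanSpace ℝ (Fin d) =>
      f p.2.1 p.2.2 (u p.2.1 p.1) (v p.2.1 p.1) := by
  have h1 : Measurable fun p : Omega × ℝ × EuclideanSpace ℝ (Fin d) => (p.2.1, p.1) :=
    measurable_snd.fst.prodMk measurable_fst
  exact hR.measurable.comp (measurable_snd.fst.prodMk (measurable_snd.snd.prodMk
    ((hu.comp h1).prodMk (hv.comp h1))))

theorem measurable_fixed (hR : IsRegular f g C D K L) {u : ℝ → Omega → A} {v : ℝ → Omega → B}
    (hu : Measurable (Function.uncurry u)) (hv : Measurable (Function.uncurry v)) (ω : Omega) :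
    Measurable (Function.uncurry fun r y => f r y (u r ω) (v r ω)) :=
  (hR.measurable_param hu hv).comp (measurable_const.prodMk measurable_id)

theorem isIntSol_sol (hR : IsRegular f g C D K L) {u : ℝ → Omega → A} {v : ℝ → Omega → B}
    (hu : Measurable (Function.uncurry u)) (hv : Measurable (Function.uncurry v)) (t : ℝ)
    (x : EuclideanSpace ℝ (Fin d)) (ω : Omega) :
    IsIntSol (fun r y => f r y (u r ω) (v r ω)) t T x
      (sol f T t x (fun r => u r ω) fun r => v r ω) := by
  obtain ⟨X, hX, -⟩ := exists_isIntSol_tendsto_picardIter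
    (h := fun ω r y => f r y (u r ω) (v r ω)) (hR.measurable_param hu hv)
    (fun _ _ _ => hR.bound _ _ _ _) (fun _ _ => hR.lipschitz _ _ _) t T x ω
  exact Classical.epsilon_spec (p := IsSol f T t x (fun r => u r ω) fun r => v r ω) ⟨X, hX⟩

theorem norm_sol_sub_le (hR : IsRegular f g C D K L) {u u' : ℝ → Omega → A} {v v' : ℝ → Omega → B}
    (hu : Measurable (Function.uncurry u)) (hv : Measurable (Function.uncurry v))
    (hu' : Measurable (Function.uncurry u')) (hv' : Measurable (Function.uncurry v')) {t t' : ℝ}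
    (htt' : t ≤ t') (ht' : t' ≤ T) (x x' : EuclideanSpace ℝ (Fin d)) {ω : Omega}
    (huu' : ∀ᵐ r, r ∈ Icc t' T → u r ω = u' r ω) (hvv' : ∀ᵐ r, r ∈ Icc t' T → v r ω = v' r ω) :
    ‖sol f T t x (fun r => u r ω) (fun r => v r ω) T
      - sol f T t' x' (fun r => u' r ω) (fun r => v' r ω) T‖
      ≤ (‖x - x'‖ + C * (t' - t)) * Real.exp (K * (T - t')) := by
  refine norm_sub_le_of_isIntSol (hR.measurable_fixed hu hv ω) (fun _ _ => hR.bound _ _ _ _)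
    (hR.measurable_fixed hu' hv' ω) (fun _ _ => hR.bound _ _ _ _) (fun _ => hR.lipschitz _ _ _)
    htt' ht' ?_ (hR.isIntSol_sol hu hv t x ω) (hR.isIntSol_sol hu' hv' t' x' ω)
  filter_upwards [huu', hvv'] with r h1 h2 hr
  simp only [h1 hr, h2 hr]

theorem measurable_sol (hR : IsRegular f g C D K L) {u : ℝ → Omega → A} {v : ℝ → Omega → B}
    (hu : Measurable (Function.uncurry u)) (hv : Measurable (Function.uncurry v)) {t : ℝ}
    (ht : t ≤ T) (x : EuclideanSpace ℝ (Fin d)) :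
    Measurable fun ω => sol f T t x (fun r => u r ω) (fun r => v r ω) T := by
  refine measurable_of_tendsto_metrizable (fun k => (measurable_picardIter
    (h := fun ω r y => f r y (u r ω) (v r ω)) (hR.measurable_param hu hv) t x k).comp (measurable_id.prodMk (measurable_const (a := T))))
    (tendsto_pi_nhds.2 fun ω => ?_)
  obtain ⟨X, hX, hXl⟩ := exists_isIntSol_tendsto_picardIter
    (h := fun ω r y => f r y (u r ω) (v r ω)) (hR.measurable_param hu hv)
    (fun _ _ _ => hR.bound _ _ _ _) (fun _ _ => hR.lipschitz _ _ _) t T x ω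
  have := norm_sub_le_of_isIntSol (hR.measurable_fixed hu hv ω) (fun _ _ => hR.bound _ _ _ _)
    (hR.measurable_fixed hu hv ω) (fun _ _ => hR.bound _ _ _ _) (fun _ => hR.lipschitz _ _ _)
    le_rfl ht (Eventually.of_forall fun _ _ => rfl) hX (hR.isIntSol_sol hu hv t x ω)
  simp only [sub_self, norm_zero, mul_zero, add_zero, zero_mul, norm_le_zero_iff,
    sub_eq_zero] at this
  rw [← this]
  exact hXl T ⟨ht, le_rfl⟩

end IsRegular

variable [Nonempty A] [Nonempty B] {P : Measure Omega} {π : Partition T}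

theorem isFix_fixPair [SFinite P] {t : ℝ} (ht : 0 ≤ t)
    {α : (ℝ → Omega → B) → (ℝ → Omega → A)} {β : (ℝ → Omega → A) → (ℝ → Omega → B)}
    (hα : IsNAD1 A B P π t α) (hβ : IsNAD2 A B P π t β) :
    IsFix Gsig Hsig P π t α β (fixPair P π t T α β).1 (fixPair P π t T α β).2 := by
  obtain ⟨u, v, h⟩ := exists_isFix (G := Gsig) (H := Hsig) ht hα hβ
  exact Classical.epsilon_spec
    (p := fun p : (ℝ → Omega → A) × (ℝ → Omega → B) => IsFixPair P π t T α β p.1 p.2) ⟨(u, v), h⟩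

namespace IsRegular

theorem abs_payoff_le (hR : IsRegular f g C D K L) (t : ℝ) (x : EuclideanSpace ℝ (Fin d))
    (α : (ℝ → Omega → B) → (ℝ → Omega → A)) (β : (ℝ → Omega → A) → (ℝ → Omega → B)) (ω : Omega) :
    |payoff f g P π t x α β ω| ≤ D :=
  hR.payoff_bound _

theorem integrable_payoff (hR : IsRegular f g C D K L) [IsFiniteMeasure P] {t : ℝ}
    (ht : t ∈ Icc 0 T) (x : EuclideanSpace ℝ (Fin d))
    {α : (ℝ → Omega → B) → (ℝ → Omega → A)} {β : (ℝ → Omega → A) → (ℝ → Omega → B)}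
    (hα : IsNAD1 A B P π t α) (hβ : IsNAD2 A B P π t β) :
    Integrable (payoff f g P π t x α β) P := by
  have h := isFix_fixPair ht.1 hα hβ
  refine Integrable.of_bound (C := D) (Measurable.aestronglyMeasurable ?_)
    (Eventually.of_forall (hR.abs_payoff_le t x α β))
  exact hR.payoff_lipschitz.continuous.measurable.comp (hR.measurable_sol h.1.1 h.2.1.1 ht.2 x)

theorem abs_payoff_sub_le (hR : IsRegular f g C D K L) [SFinite P] {t t' : ℝ}
    (ht : 0 ≤ t) (htt' : t ≤ t') (ht' : t' ≤ T) (x x' : EuclideanSpace ℝ (Fin d)) {S : Set Omega}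
    {α α' : (ℝ → Omega → B) → (ℝ → Omega → A)} {β β' : (ℝ → Omega → A) → (ℝ → Omega → B)}
    (hα : IsNAD1 A B P π t α) (hβ : IsNAD2 A B P π t β)
    (hα' : IsNAD1 A B P π t' α') (hβ' : IsNAD2 A B P π t' β')
    (h : AeEqOn P S t' T (fixPair P π t T α β).1 (fixPair P π t' T α' β').1 ∧
      AeEqOn P S t' T (fixPair P π t T α β).2 (fixPair P π t' T α' β').2) :
    ∀ᵐ ω ∂P, ω ∈ S → |payoff f g P π t x α β ω - payoff f g P π t' x' α' β' ω|
      ≤ L * ((‖x - x'‖ + C * (t' - t)) * Real.exp (K * (T - t'))) := by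
  have hswap : ∀ {F : Type} {w w' : ℝ → Omega → F}, AeEqOn P S t' T w w' →
      ∀ᵐ ω ∂P, ω ∈ S → ∀ᵐ r, r ∈ Icc t' T → w r ω = w' r ω := by
    intro F w w' hw
    have hw' : ∀ᵐ p ∂(P.prod (volume : Measure ℝ)),
        p.1 ∈ S → p.2 ∈ Icc t' T → w p.2 p.1 = w' p.2 p.1 :=
      (Measure.measurePreserving_swap (μ := P) (ν := (volume : Measure ℝ))
        ).quasiMeasurePreserving.ae hw
    filter_upwards [Measure.ae_ae_of_ae_prod hw'] with ω hω hωS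
    filter_upwards [hω] with r hr using hr hωS
  have hf := isFix_fixPair ht hα hβ
  have hf' := isFix_fixPair (ht.trans htt') hα' hβ'
  filter_upwards [hswap h.1, hswap h.2] with ω h1 h2 hωS
  have := hR.norm_sol_sub_le hf.1.1 hf.2.1.1 hf'.1.1 hf'.2.1.1 htt' ht' x x' (h1 hωS) (h2 hωS)
  refine le_trans ?_ (mul_le_mul_of_nonneg_left this L.2)
  simpa [dist_eq_norm, Real.dist_eq] using! hR.payoff_lipschitz.dist_le_mul _ _

theorem payoff_ae_eq_on (hR : IsRegular f g C D K L) [SFinite P] {t : ℝ} (ht : t ∈ Icc 0 T)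
    (x : EuclideanSpace ℝ (Fin d)) {S : Set Omega} (hS : MeasurableSet[Fsig (π.idx t)] S)
    {α α' : (ℝ → Omega → B) → (ℝ → Omega → A)} {β β' : (ℝ → Omega → A) → (ℝ → Omega → B)}
    (hα : IsNAD1 A B P π t α) (hβ : IsNAD2 A B P π t β)
    (hα' : IsNAD1 A B P π t α') (hβ' : IsNAD2 A B P π t β')
    (hαα' : ∀ v, AeEqOn P S t T (α v) (α' v)) (hββ' : ∀ u, AeEqOn P S t T (β u) (β' u)) :
    ∀ᵐ ω ∂P, ω ∈ S → payoff f g P π t x α β ω = payoff f g P π t x α' β' ω := by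
  have h := IsFix.aeEqOn ht.1 hS (G := Gsig) (H := Hsig) hα hβ (fun v _ => hαα' v)
    (fun u _ => hββ' u) (isFix_fixPair ht.1 hα hβ) (isFix_fixPair ht.1 hα' hβ')
  filter_upwards [hR.abs_payoff_sub_le ht.1 le_rfl ht.2 x x hα hβ hα' hβ' h] with ω hω hωS
  simpa [sub_eq_zero] using hω hωS

end IsRegular

/-! ### The value functions as values of a game with expected pay-off -/

theorem pasteCtrl_aeEqOn {E : Type} {t : ℝ} (c : E) {S : Set Omega} (u u' : ℝ → Omega → E) :
    AeEqOn P S t T (pasteCtrl t c S u u') u ∧ AeEqOn P Sᶜ t T (pasteCtrl t c S u u') u' := by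
  constructor <;> refine Eventually.of_forall fun p hp hI => ?_
  · simp [pasteCtrl, hI.1.not_gt, hp]
  · simp [pasteCtrl, hI.1.not_gt, show p.2 ∉ S from hp]

instance (t : ℝ) : Nonempty {α // IsNAD1 A B P π t α} :=
  ⟨⟨_, isNAD_const (G := Gsig) (H := Hsig) (Classical.arbitrary A)⟩⟩

instance (t : ℝ) : Nonempty {β // IsNAD2 A B P π t β} :=
  ⟨⟨_, isNAD_const (G := Hsig) (H := Gsig) (Classical.arbitrary B)⟩⟩

namespace IsRegular

variable [IsProbabilityMeasure P]

theorem exists_paste_left (hR : IsRegular f g C D K L) {t : ℝ} (ht : t ∈ Icc 0 T)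
    (x : EuclideanSpace ℝ (Fin d)) (α₁ α₂ : {α // IsNAD1 A B P π t α}) (S : Set Omega)
    (hS : MeasurableSet[Fsig (π.idx t)] S) :
    ∃ α : {α // IsNAD1 A B P π t α}, ∀ β : {β // IsNAD2 A B P π t β},
      (∀ᵐ ω ∂P, ω ∈ S → payoff f g P π t x α.1 β.1 ω = payoff f g P π t x α₁.1 β.1 ω) ∧
      ∀ᵐ ω ∂P, ω ∈ Sᶜ → payoff f g P π t x α.1 β.1 ω = payoff f g P π t x α₂.1 β.1 ω := by
  have hα := IsNAD.paste (G := Gsig) (H := Hsig) ht.1 le_rfl (Classical.arbitrary A) hS α₁.2 α₂.2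
  exact ⟨⟨_, hα⟩, fun β =>
    ⟨hR.payoff_ae_eq_on ht x hS hα β.2 α₁.2 β.2 (fun _ => (pasteCtrl_aeEqOn _ _ _).1)
        fun _ => .refl,
      hR.payoff_ae_eq_on ht x hS.compl hα β.2 α₂.2 β.2 (fun _ => (pasteCtrl_aeEqOn _ _ _).2)
        fun _ => .refl⟩⟩

theorem exists_paste_right (hR : IsRegular f g C D K L) {t : ℝ} (ht : t ∈ Icc 0 T)
    (x : EuclideanSpace ℝ (Fin d)) (β₁ β₂ : {β // IsNAD2 A B P π t β}) (S : Set Omega)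
    (hS : MeasurableSet[Fsig (π.idx t)] S) :
    ∃ β : {β // IsNAD2 A B P π t β}, ∀ α : {α // IsNAD1 A B P π t α},
      (∀ᵐ ω ∂P, ω ∈ S → payoff f g P π t x α.1 β.1 ω = payoff f g P π t x α.1 β₁.1 ω) ∧
      ∀ᵐ ω ∂P, ω ∈ Sᶜ → payoff f g P π t x α.1 β.1 ω = payoff f g P π t x α.1 β₂.1 ω := by
  have hβ := IsNAD.paste (G := Hsig) (H := Gsig) ht.1 le_rfl (Classical.arbitrary B) hS β₁.2 β₂.2
  exact ⟨⟨_, hβ⟩, fun α =>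
    ⟨hR.payoff_ae_eq_on ht x hS α.2 hβ α.2 β₁.2 (fun _ => .refl)
        fun _ => (pasteCtrl_aeEqOn _ _ _).1,
      hR.payoff_ae_eq_on ht x hS.compl α.2 hβ α.2 β₂.2 (fun _ => .refl)
        fun _ => (pasteCtrl_aeEqOn _ _ _).2⟩⟩

theorem lowerValD_eq (hR : IsRegular f g C D K L) {t : ℝ} (ht : t ∈ Icc 0 T)
    (x : EuclideanSpace ℝ (Fin d)) :
    lowerValD A B f g P π t x = ⨆ α : {α // IsNAD1 A B P π t α}, ⨅ β : {β // IsNAD2 A B P π t β},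
      ∫ ω, payoff f g P π t x α.1 β.1 ω ∂P := by
  obtain ⟨J, S, hJ, hS, hinteg⟩ := exists_essSup_essInf_condExp (P := P) (Fsig_le (π.idx t))
    (p := fun (α : {α // IsNAD1 A B P π t α}) (β : {β // IsNAD2 A B P π t β}) =>
      payoff f g P π t x α.1 β.1)
    (fun α β => hR.integrable_payoff ht x α.2 β.2) (fun α β => hR.abs_payoff_le t x α.1 β.1)
    (hR.exists_paste_left ht x) (hR.exists_paste_right ht x)
  obtain ⟨J', hJ', hS'⟩ : IsLowerVal A B f g P π t x (lowerVal A B f g P π t x) :=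
    Classical.epsilon_spec (p := IsLowerVal A B f g P π t x) ⟨S, J, hJ, hS⟩
  have hJJ' : ∀ α, J' α =ᵐ[P] J α := fun α => (hJ' α).ae_eq (hJ α)
  rw [← hinteg]
  exact integral_congr_ae ((hS'.congr hJJ').ae_eq hS)

theorem upperValD_eq (hR : IsRegular f g C D K L) {t : ℝ} (ht : t ∈ Icc 0 T)
    (x : EuclideanSpace ℝ (Fin d)) :
    upperValD A B f g P π t x = -⨆ β : {β // IsNAD2 A B P π t β}, ⨅ α : {α // IsNAD1 A B P π t α},
      -∫ ω, payoff f g P π t x α.1 β.1 ω ∂P := by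
  obtain ⟨J, S, hJ, hS, hinteg⟩ := exists_essSup_essInf_condExp (P := P) (Fsig_le (π.idx t))
    (p := fun (β : {β // IsNAD2 A B P π t β}) (α : {α // IsNAD1 A B P π t α}) =>
      -payoff f g P π t x α.1 β.1)
    (C := D)
    (fun β α => (hR.integrable_payoff ht x α.2 β.2).neg)
    (fun β α ω => by simpa using hR.abs_payoff_le t x α.1 β.1 ω)
    (fun β₁ β₂ Q hQ => by simpa using hR.exists_paste_right ht x β₁ β₂ Q hQ)
    (fun α₁ α₂ Q hQ => by simpa using hR.exists_paste_left ht x α₁ α₂ Q hQ)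
  have hval : IsUpperVal A B f g P π t x (-S) := by
    refine ⟨fun β => -J β, fun β => ?_, ?_⟩
    · refine (isEssSupFam_neg_iff.2 (hJ β)).congr fun α => ?_
      filter_upwards [condExp_neg (μ := P) (payoff f g P π t x α.1 β.1) (Fsig (π.idx t))] with ω hω
      simp [hω]
    · rw [← isEssSupFam_neg_iff]
      simpa only [neg_neg] using hS
  obtain ⟨J', hJ', hS'⟩ : IsUpperVal A B f g P π t x (upperVal A B f g P π t x) :=
    Classical.epsilon_spec (p := IsUpperVal A B f g P π t x) ⟨_, hval⟩
  obtain ⟨J₁, hJ₁, hS₁⟩ := hval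
  have hJJ' : ∀ β, J' β =ᵐ[P] J₁ β := fun β => (hJ' β).ae_eq (hJ₁ β)
  have key : upperVal A B f g P π t x =ᵐ[P] -S := (hS'.congr hJJ').ae_eq hS₁
  rw [upperValD, integral_congr_ae key]
  simp only [Pi.neg_apply, integral_neg] at hinteg ⊢
  rw [hinteg]

/-! ### Lipschitz continuity of the value functions -/

theorem abs_integral_payoff_sub_le (hR : IsRegular f g C D K L) {t t' : ℝ}
    (ht : 0 ≤ t) (htt' : t ≤ t') (ht' : t' ≤ T) (x x' : EuclideanSpace ℝ (Fin d))
    {α α' : (ℝ → Omega → B) → (ℝ → Omega → A)} {β β' : (ℝ → Omega → A) → (ℝ → Omega → B)}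
    (hα : IsNAD1 A B P π t α) (hβ : IsNAD2 A B P π t β)
    (hα' : IsNAD1 A B P π t' α') (hβ' : IsNAD2 A B P π t' β')
    (h : IsFix Gsig Hsig P π t' α' β' (fixPair P π t T α β).1 (fixPair P π t T α β).2) :
    |∫ ω, payoff f g P π t x α β ω ∂P - ∫ ω, payoff f g P π t' x' α' β' ω ∂P|
      ≤ L * ((‖x - x'‖ + C * (t' - t)) * Real.exp (K * (T - t'))) := by
  rw [← integral_sub (hR.integrable_payoff ⟨ht, htt'.trans ht'⟩ x hα hβ)
    (hR.integrable_payoff ⟨ht.trans htt', ht'⟩ x' hα' hβ')]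
  have hu := IsFix.aeEqOn (ht.trans htt') (S := univ) MeasurableSet.univ hα' hβ'
    (fun _ _ => .refl) (fun _ _ => .refl) h (isFix_fixPair (ht.trans htt') hα' hβ')
  refine abs_integral_le_of_ae ?_
  filter_upwards [hR.abs_payoff_sub_le ht htt' ht' x x' hα hβ hα' hβ' hu] with ω hω
    using hω (mem_univ ω)

theorem exists_integral_payoff_left (hR : IsRegular f g C D K L) {t t' : ℝ}
    (ht : 0 ≤ t) (htt' : t ≤ t') (ht' : t' ≤ T) (x x' : EuclideanSpace ℝ (Fin d)) :
    ∃ (R : {α // IsNAD1 A B P π t α} → {α // IsNAD1 A B P π t' α})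
      (Q : {β // IsNAD2 A B P π t' β} → {β // IsNAD2 A B P π t β}), ∀ α β,
      |∫ ω, payoff f g P π t x α.1 (Q β).1 ω ∂P - ∫ ω, payoff f g P π t' x' (R α).1 β.1 ω ∂P|
      ≤ L * ((‖x - x'‖ + C * (t' - t)) * Real.exp (K * (T - t'))) := by
  let c : B := Classical.arbitrary B
  refine ⟨fun α => ⟨_, IsNAD.comp_paste (G := Gsig) (H := Hsig) ht htt' c α.2⟩,
    fun β => ⟨_, IsNAD.paste (G := Hsig) (H := Gsig) ht htt' c MeasurableSet.univ β.2 β.2⟩,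
    fun α β => hR.abs_integral_payoff_sub_le ht htt' ht' x x' α.2 (Subtype.property _)
      (Subtype.property _) β.2 (IsFix.of_paste ht htt' c α.2 (isFix_fixPair ht α.2
        (IsNAD.paste (G := Hsig) (H := Gsig) ht htt' c MeasurableSet.univ β.2 β.2)))⟩

theorem exists_integral_payoff_right (hR : IsRegular f g C D K L) {t t' : ℝ}
    (ht : 0 ≤ t) (htt' : t ≤ t') (ht' : t' ≤ T) (x x' : EuclideanSpace ℝ (Fin d)) :
    ∃ (R : {β // IsNAD2 A B P π t β} → {β // IsNAD2 A B P π t' β})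
      (Q : {α // IsNAD1 A B P π t' α} → {α // IsNAD1 A B P π t α}), ∀ α β,
      |∫ ω, payoff f g P π t x (Q α).1 β.1 ω ∂P - ∫ ω, payoff f g P π t' x' α.1 (R β).1 ω ∂P|
      ≤ L * ((‖x - x'‖ + C * (t' - t)) * Real.exp (K * (T - t'))) := by
  let c : A := Classical.arbitrary A
  refine ⟨fun β => ⟨_, IsNAD.comp_paste (G := Hsig) (H := Gsig) ht htt' c β.2⟩,
    fun α => ⟨_, IsNAD.paste (G := Gsig) (H := Hsig) ht htt' c MeasurableSet.univ α.2 α.2⟩,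
    fun α β => hR.abs_integral_payoff_sub_le ht htt' ht' x x' (Subtype.property _) β.2
      α.2 (Subtype.property _) (IsFix.of_paste ht htt' c β.2 (isFix_fixPair ht
        (IsNAD.paste (G := Gsig) (H := Hsig) ht htt' c MeasurableSet.univ α.2 α.2) β.2).swap).swap⟩

end IsRegular

theorem iSup_iInf_le_add {ι κ ι' κ' : Type*} [Nonempty ι] [Nonempty κ] [Nonempty κ']
    {F : ι → κ → ℝ} {F' : ι' → κ' → ℝ} {D ε : ℝ} (hF : ∀ i k, |F i k| ≤ D)
    (hF' : ∀ i k, |F' i k| ≤ D) (h : ∀ i, ∃ i', ∀ k', ∃ k, F i k ≤ F' i' k' + ε) :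
    ⨆ i, ⨅ k, F i k ≤ (⨆ i, ⨅ k, F' i k) + ε := by
  have hb : ∀ i, BddBelow (range (F i)) := fun i =>
    ⟨-D, by rintro _ ⟨k, rfl⟩; exact (abs_le.1 (hF i k)).1⟩
  have hb' : ∀ i, BddBelow (range (F' i)) := fun i =>
    ⟨-D, by rintro _ ⟨k, rfl⟩; exact (abs_le.1 (hF' i k)).1⟩
  have hB : BddAbove (range fun i => ⨅ k, F' i k) := by
    refine ⟨D, ?_⟩
    rintro _ ⟨i, rfl⟩
    exact (ciInf_le (hb' i) (Classical.arbitrary κ')).trans (abs_le.1 (hF' i _)).2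
  refine ciSup_le fun i => ?_
  obtain ⟨i', hi'⟩ := h i
  have : (⨅ k, F i k) - ε ≤ ⨅ k, F' i' k := by
    refine le_ciInf fun k' => ?_
    obtain ⟨k, hk⟩ := hi' k'
    linarith [ciInf_le (hb i) k]
  linarith [le_ciSup hB i']

theorem abs_iSup_iInf_le {ι κ : Type*} [Nonempty ι] [Nonempty κ] {F : ι → κ → ℝ} {D : ℝ}
    (hF : ∀ i k, |F i k| ≤ D) : |⨆ i, ⨅ k, F i k| ≤ D := by
  have hb : ∀ i, BddBelow (range (F i)) := fun i =>
    ⟨-D, by rintro _ ⟨k, rfl⟩; exact (abs_le.1 (hF i k)).1⟩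
  have hle : ∀ i, ⨅ k, F i k ≤ D := fun i =>
    (ciInf_le (hb i) (Classical.arbitrary κ)).trans (abs_le.1 (hF i _)).2
  refine abs_le.2 ⟨?_, ciSup_le hle⟩
  refine le_trans (le_ciInf fun k => (abs_le.1 (hF (Classical.arbitrary ι) k)).1)
    (le_ciSup (f := fun i => ⨅ k, F i k) ⟨D, ?_⟩ (Classical.arbitrary ι))
  rintro _ ⟨i, rfl⟩
  exact hle i

namespace IsRegular

variable [IsProbabilityMeasure P]

theorem abs_integral_payoff_le (hR : IsRegular f g C D K L) (t : ℝ)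
    (x : EuclideanSpace ℝ (Fin d)) (α : (ℝ → Omega → B) → (ℝ → Omega → A))
    (β : (ℝ → Omega → A) → (ℝ → Omega → B)) : |∫ ω, payoff f g P π t x α β ω ∂P| ≤ D :=
  abs_integral_le_of_ae (Eventually.of_forall (hR.abs_payoff_le t x α β))

theorem abs_lowerValD_le (hR : IsRegular f g C D K L) {t : ℝ} (ht : t ∈ Icc 0 T)
    (x : EuclideanSpace ℝ (Fin d)) : |lowerValD A B f g P π t x| ≤ D := by
  rw [hR.lowerValD_eq ht]
  exact abs_iSup_iInf_le fun α β => hR.abs_integral_payoff_le t x α.1 β.1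

theorem abs_upperValD_le (hR : IsRegular f g C D K L) {t : ℝ} (ht : t ∈ Icc 0 T)
    (x : EuclideanSpace ℝ (Fin d)) : |upperValD A B f g P π t x| ≤ D := by
  rw [hR.upperValD_eq ht, abs_neg]
  exact abs_iSup_iInf_le fun β α => by
    rw [abs_neg]
    exact hR.abs_integral_payoff_le t x α.1 β.1

theorem abs_lowerValD_sub_le (hR : IsRegular f g C D K L) {t t' : ℝ}
    (ht : 0 ≤ t) (htt' : t ≤ t') (ht' : t' ≤ T) (x x' : EuclideanSpace ℝ (Fin d)) :
    |lowerValD A B f g P π t x - lowerValD A B f g P π t' x'|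
      ≤ L * ((‖x - x'‖ + C * (t' - t)) * Real.exp (K * (T - t'))) := by
  rw [hR.lowerValD_eq ⟨ht, htt'.trans ht'⟩, hR.lowerValD_eq ⟨ht.trans htt', ht'⟩]
  have hb := fun (s : ℝ) (y : EuclideanSpace ℝ (Fin d)) (α : {α // IsNAD1 A B P π s α})
    (β : {β // IsNAD2 A B P π s β}) =>
    hR.abs_integral_payoff_le (P := P) (π := π) s y α.1 β.1
  refine abs_sub_le_iff.2 ⟨sub_le_iff_le_add'.2 ?_, sub_le_iff_le_add'.2 ?_⟩ <;>
    refine iSup_iInf_le_add (hb _ _) (hb _ _) fun α => ?_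
  · obtain ⟨R, Q, h⟩ := hR.exists_integral_payoff_left (P := P) (π := π) ht htt' ht' x x'
    exact ⟨R α, fun β => ⟨Q β, sub_le_iff_le_add'.1 (abs_sub_le_iff.1 (h α β)).1⟩⟩
  · obtain ⟨R, Q, h⟩ := hR.exists_integral_payoff_right (P := P) (π := π) ht htt' ht' x x'
    exact ⟨Q α, fun β => ⟨R β, sub_le_iff_le_add'.1 (abs_sub_le_iff.1 (h α β)).2⟩⟩

theorem abs_upperValD_sub_le (hR : IsRegular f g C D K L) {t t' : ℝ}
    (ht : 0 ≤ t) (htt' : t ≤ t') (ht' : t' ≤ T) (x x' : EuclideanSpace ℝ (Fin d)) :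
    |upperValD A B f g P π t x - upperValD A B f g P π t' x'|
      ≤ L * ((‖x - x'‖ + C * (t' - t)) * Real.exp (K * (T - t'))) := by
  rw [hR.upperValD_eq ⟨ht, htt'.trans ht'⟩, hR.upperValD_eq ⟨ht.trans htt', ht'⟩,
    neg_sub_neg, abs_sub_comm]
  have hb : ∀ (s : ℝ) (y : EuclideanSpace ℝ (Fin d)) (β : {β // IsNAD2 A B P π s β})
      (α : {α // IsNAD1 A B P π s α}), |-∫ ω, payoff f g P π s y α.1 β.1 ω ∂P| ≤ D :=
    fun s y β α => by
      rw [abs_neg]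
      exact hR.abs_integral_payoff_le s y α.1 β.1
  refine abs_sub_le_iff.2 ⟨sub_le_iff_le_add'.2 ?_, sub_le_iff_le_add'.2 ?_⟩ <;>
    refine iSup_iInf_le_add (hb _ _) (hb _ _) fun β => ?_
  · obtain ⟨R, Q, h⟩ := hR.exists_integral_payoff_right (P := P) (π := π) ht htt' ht' x x'
    exact ⟨R β, fun α => ⟨Q α, by linarith [(abs_sub_le_iff.1 (h α β)).2]⟩⟩
  · obtain ⟨R, Q, h⟩ := hR.exists_integral_payoff_left (P := P) (π := π) ht htt' ht' x x'
    exact ⟨Q β, fun α => ⟨R α, by linarith [(abs_sub_le_iff.1 (h α β)).1]⟩⟩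

end IsRegular

end Game

/-! ### Extraction of a locally uniformly convergent subsequence -/

theorem tendstoUniformlyOn_of_lipschitzOnWith {X Y : Type*} [PseudoMetricSpace X]
    [PseudoMetricSpace Y] {F : ℕ → X → Y} {G : X → Y} {K : ℝ≥0} {s S : Set X}
    (hF : ∀ n, LipschitzOnWith K (F n) S) (hG : LipschitzOnWith K G S)
    (hlim : ∀ x ∈ S, Tendsto (fun n => F n x) atTop (𝓝 (G x))) (hs : IsCompact s) (hsS : s ⊆ S) :
    TendstoUniformlyOn F G atTop s := by
  refine Metric.tendstoUniformlyOn_iff.2 fun ε hε => ?_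
  have hK : (0 : ℝ) < K + 1 := by positivity
  set δ := ε / (4 * (K + 1)) with hδ
  have hδ0 : 0 < δ := by positivity
  have hδε : K * δ ≤ ε / 4 := by
    rw [hδ, mul_div_assoc', div_le_div_iff₀ (by positivity) (by norm_num)]
    nlinarith
  obtain ⟨t, hts, ht, hcov⟩ := hs.finite_cover_balls hδ0
  have hfin : ∀ᶠ n in atTop, ∀ y ∈ t, dist (F n y) (G y) < ε / 4 :=
    (eventually_all_finite ht).2 fun y hy =>
      (hlim y (hsS (hts hy))).eventually (Metric.ball_mem_nhds _ (by positivity))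
  filter_upwards [hfin] with n hn x hx
  obtain ⟨y, hy, hxy⟩ := mem_iUnion₂.1 (hcov hx)
  have h1 := hG.dist_le_mul x (hsS hx) y (hsS (hts hy))
  have h2 := (hF n).dist_le_mul y (hsS (hts hy)) x (hsS hx)
  rw [dist_comm y x] at h2
  have h3 : K * dist x y ≤ K * δ := by
    gcongr
    exact (Metric.mem_ball.1 hxy).le
  calc dist (G x) (F n x) ≤ dist (G x) (G y) + dist (G y) (F n y) + dist (F n y) (F n x) :=
        dist_triangle4 _ _ _ _
    _ < ε := by
        rw [dist_comm (G y)]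
        linarith [hn y hy]

/-- A uniformly bounded, uniformly Lipschitz sequence has a subsequence converging locally
uniformly. -/
theorem exists_subseq_tendstoUniformlyOn {X Y : Type*} [PseudoMetricSpace X]
    [SecondCountableTopology X] [MetricSpace Y] [ProperSpace Y] {F : ℕ → X → Y} {K : ℝ≥0}
    {S : Set X} {c : Y} {D : ℝ} (hF : ∀ n, LipschitzOnWith K (F n) S)
    (hb : ∀ n, ∀ x ∈ S, F n x ∈ Metric.closedBall c D) :
    ∃ φ : ℕ → ℕ, StrictMono φ ∧ ∃ G : X → Y, LipschitzOnWith K G S ∧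
      (∀ x ∈ S, G x ∈ Metric.closedBall c D) ∧
      ∀ s, IsCompact s → s ⊆ S → TendstoUniformlyOn (fun n => F (φ n)) G atTop s := by
  obtain ⟨Q, hQS, hQ, hQd⟩ := (TopologicalSpace.IsSeparable.of_separableSpace S
    ).exists_countable_dense_subset
  have := hQ.to_subtype
  obtain ⟨a, -, φ, hφ, ha⟩ :=
    (isCompact_univ_pi fun _ : Q => isCompact_closedBall c D).tendsto_subseq
    (x := fun n (q : Q) => F n q) fun n q _ => hb n q (hQS q.2)
  rw [tendsto_pi_nhds] at ha
  have hlim : ∀ x : X, ∃ y, x ∈ S → Tendsto (fun n => F (φ n) x) atTop (𝓝 y) := by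
    intro x
    by_cases hx : x ∈ S
    swap
    · exact ⟨c, fun h => absurd h hx⟩
    suffices h : CauchySeq fun n => F (φ n) x by
      obtain ⟨y, hy⟩ := cauchySeq_tendsto_of_complete h
      exact ⟨y, fun _ => hy⟩
    refine Metric.cauchySeq_iff.2 fun ε hε => ?_
    have hK : (0 : ℝ) < K + 1 := by positivity
    obtain ⟨q, hq, hxq⟩ := Metric.mem_closure_iff.1 (hQd hx) (ε / (4 * (K + 1))) (by positivity)
    obtain ⟨N, hN⟩ := Metric.cauchySeq_iff.1 (ha ⟨q, hq⟩).cauchySeq (ε / 2) (by positivity)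
    refine ⟨N, fun m hm n hn => ?_⟩
    have h1 := (hF (φ m)).dist_le_mul x hx q (hQS hq)
    have h2 := (hF (φ n)).dist_le_mul q (hQS hq) x hx
    rw [dist_comm q x] at h2
    have h3 : K * dist x q ≤ ε / 4 := by
      rw [lt_div_iff₀ (by positivity)] at hxq
      nlinarith [dist_nonneg (x := x) (y := q)]
    have h4 : dist (F (φ m) q) (F (φ n) q) < ε / 2 := hN m hm n hn
    calc dist (F (φ m) x) (F (φ n) x)
        ≤ dist (F (φ m) x) (F (φ m) q) + dist (F (φ m) q) (F (φ n) q)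
          + dist (F (φ n) q) (F (φ n) x) := dist_triangle4 _ _ _ _
      _ < ε := by linarith
  choose G hG using hlim
  have hGlip : LipschitzOnWith K G S := LipschitzOnWith.of_dist_le_mul fun x hx y hy =>
    le_of_tendsto' ((hG x hx).dist (hG y hy)) fun n => (hF _).dist_le_mul x hx y hy
  exact ⟨φ, hφ, G, hGlip, fun x hx => Metric.isClosed_closedBall.mem_of_tendsto (hG x hx)
    (Eventually.of_forall fun n => hb _ x hx),
    fun s hs hsS => tendstoUniformlyOn_of_lipschitzOnWith (fun n => hF _) hGlip hG hs hsS⟩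

/-! ### Reduction to jointly measurable dynamics -/

section Reduction

variable {d : ℕ} {A B : Type} [MeasurableSpace A] [MeasurableSpace B]
  {f f' : ℝ → EuclideanSpace ℝ (Fin d) → A → B → EuclideanSpace ℝ (Fin d)}
  {g : EuclideanSpace ℝ (Fin d) → ℝ} {C D : ℝ} {K L : ℝ≥0} {T : ℝ}

theorem payoff_congr [Nonempty A] [Nonempty B] {P : Measure Omega} {π : Partition T}
    (h : ∀ t ∈ Icc 0 T, f t = f' t) {t : ℝ} (ht : 0 ≤ t) :
    payoff f g P π t = payoff f' g P π t := by
  funext x α β ω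
  simp only [payoff, solStrat, sol_congr h ht]

theorem lowerValD_congr [Nonempty A] [Nonempty B] {P : Measure Omega} {π : Partition T}
    (h : ∀ t ∈ Icc 0 T, f t = f' t) {t : ℝ} (ht : 0 ≤ t) :
    lowerValD A B f g P π t = lowerValD A B f' g P π t := by
  have : IsLowerVal A B f g P π t = IsLowerVal A B f' g P π t := by
    funext x S
    simp only [IsLowerVal, payoff_congr h ht]
  funext x
  simp only [lowerValD, lowerVal, this]

theorem upperValD_congr [Nonempty A] [Nonempty B] {P : Measure Omega} {π : Partition T}
    (h : ∀ t ∈ Icc 0 T, f t = f' t) {t : ℝ} (ht : 0 ≤ t) :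
    upperValD A B f g P π t = upperValD A B f' g P π t := by
  have : IsUpperVal A B f g P π t = IsUpperVal A B f' g P π t := by
    funext x S
    simp only [IsUpperVal, payoff_congr h ht]
  funext x
  simp only [upperValD, upperVal, this]

theorem isRegular_indicator [TopologicalSpace A] [TopologicalSpace B] [BorelSpace A] [BorelSpace B]
    [SecondCountableTopology A] [SecondCountableTopology B]
    (hf_bdd : ∀ t x u v, ‖f t x u v‖ ≤ C)
    (hf_cont : ContinuousOn
      (fun q : ℝ × EuclideanSpace ℝ (Fin d) × A × B => f q.1 q.2.1 q.2.2.1 q.2.2.2)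
      (Icc (0 : ℝ) T ×ˢ univ))
    (hf_lip : ∀ t u v, LipschitzWith K fun x => f t x u v)
    (hg_bdd : ∀ x, |g x| ≤ D) (hg_lip : LipschitzWith L g) :
    IsRegular ((Icc 0 T).indicator f) g (max C 0) D K L where
  measurable := by
    classical
    have h := hf_cont.measurable_piecewise (g := fun _ => 0) continuousOn_const
      (measurableSet_Icc.prod MeasurableSet.univ)
    refine (congrArg Measurable (funext fun q => ?_)).mp h
    by_cases hq : q.1 ∈ Icc 0 T <;> simp [piecewise, hq]
  bound t x u v := by
    by_cases ht : t ∈ Icc 0 T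
    · simp [ht, hf_bdd]
    · simp [ht]
  lipschitz t u v := by
    by_cases ht : t ∈ Icc 0 T
    · simpa [ht] using hf_lip t u v
    · simpa [ht] using (LipschitzWith.const 0).weaken K.2
  payoff_bound := hg_bdd
  payoff_lipschitz := hg_lip

theorem lipschitzOnWith_of_abs_sub_le {E : Type*} [SeminormedAddCommGroup E] {W : ℝ → E → ℝ}
    (hC : 0 ≤ C)
    (h : ∀ t t', 0 ≤ t → t ≤ t' → t' ≤ T → ∀ x x', |W t x - W t' x'|
      ≤ L * ((‖x - x'‖ + C * (t' - t)) * Real.exp (K * (T - t')))) :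
    LipschitzOnWith (L * ((1 + C.toNNReal) * (Real.exp (K * T)).toNNReal))
      (fun q : ℝ × E => W q.1 q.2) (Icc 0 T ×ˢ univ) := by
  have key : ∀ t t', 0 ≤ t → t ≤ t' → t' ≤ T → ∀ x x', |W t x - W t' x'|
      ≤ L * ((1 + C) * Real.exp (K * T)) * dist (t, x) (t', x') := by
    intro t t' ht htt' ht' x x'
    have h1 : ‖x - x'‖ ≤ dist (t, x) (t', x') := by
      rw [← dist_eq_norm]
      exact le_max_right _ _
    have h2 : t' - t ≤ dist (t, x) (t', x') := by
      refine le_trans ?_ (le_max_left _ _)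
      rw [dist_comm]
      exact le_abs_self _
    have h3 : Real.exp (K * (T - t')) ≤ Real.exp (K * T) := by
      gcongr
      linarith
    calc |W t x - W t' x'| ≤ L * ((‖x - x'‖ + C * (t' - t)) * Real.exp (K * (T - t'))) :=
          h t t' ht htt' ht' x x'
      _ ≤ L * ((dist (t, x) (t', x') + C * dist (t, x) (t', x')) * Real.exp (K * T)) := by gcongr
      _ = _ := by ring
  refine LipschitzOnWith.of_dist_le_mul fun p hp q hq => ?_
  rw [Real.dist_eq]
  push_cast
  rw [Real.coe_toNNReal _ hC, Real.coe_toNNReal _ (Real.exp_pos _).le]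
  rcases le_total p.1 q.1 with h' | h'
  · exact key _ _ hp.1.1 h' hq.1.2 _ _
  · rw [abs_sub_comm, dist_comm]
    exact key _ _ hq.1.1 h' hp.1.2 _ _

end Reduction

/-- **Lemma 4.1.** For any sequence of partitions `(Π_n)` with mesh tending to `0`
there exist a subsequence and bounded Lipschitz functions `V, U : [0,T] × ℝ^d → ℝ` such that
`(V^{Π_n}, U^{Π_n}) → (V, U)` uniformly on compact subsets of `[0,T] × ℝ^d`. -/
theorem statement_11
    {d : ℕ} {U V : Type} [MetricSpace U] [CompactSpace U] [MetricSpace V] [CompactSpace V]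
    [MeasurableSpace U] [BorelSpace U] [MeasurableSpace V] [BorelSpace V]
    [Nonempty U] [Nonempty V]
    (T : ℝ) (hT : 0 < T)
    (f : ℝ → EuclideanSpace ℝ (Fin d) → U → V → EuclideanSpace ℝ (Fin d))
    (hf_bdd : ∃ C : ℝ, ∀ t x u v, ‖f t x u v‖ ≤ C)
    (hf_cont : ContinuousOn
      (fun q : ℝ × EuclideanSpace ℝ (Fin d) × U × V => f q.1 q.2.1 q.2.2.1 q.2.2.2)
      (Icc (0 : ℝ) T ×ˢ univ))
    (hf_lip : ∃ K : ℝ≥0, ∀ t u v, LipschitzWith K fun x => f t x u v)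
    (g : EuclideanSpace ℝ (Fin d) → ℝ)
    (hg_bdd : ∃ C : ℝ, ∀ x, |g x| ≤ C)
    (hg_lip : ∃ K : ℝ≥0, LipschitzWith K g)
    (P : Measure Omega) [IsProbabilityMeasure P] (hP : IsProductMeasure P)
    (prt : ℕ → Partition T)
    (hmesh : Tendsto (fun n => (prt n).mesh) atTop (𝓝 0)) :
    ∃ φ : ℕ → ℕ, StrictMono φ ∧
    ∃ Vl Ul : ℝ → EuclideanSpace ℝ (Fin d) → ℝ,
      (∃ M : ℝ, ∀ t ∈ Icc (0 : ℝ) T, ∀ x, |Vl t x| ≤ M ∧ |Ul t x| ≤ M) ∧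
      (∃ K : ℝ≥0,
        LipschitzOnWith K (fun q : ℝ × EuclideanSpace ℝ (Fin d) => Vl q.1 q.2)
          (Icc (0 : ℝ) T ×ˢ univ) ∧
        LipschitzOnWith K (fun q : ℝ × EuclideanSpace ℝ (Fin d) => Ul q.1 q.2)
          (Icc (0 : ℝ) T ×ˢ univ)) ∧
      ∀ K : Set (ℝ × EuclideanSpace ℝ (Fin d)), IsCompact K → K ⊆ Icc (0 : ℝ) T ×ˢ univ →
        TendstoUniformlyOn (fun k q => lowerValD U V f g P (prt (φ k)) q.1 q.2)
          (fun q => Vl q.1 q.2) atTop K ∧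
        TendstoUniformlyOn (fun k q => upperValD U V f g P (prt (φ k)) q.1 q.2)
          (fun q => Ul q.1 q.2) atTop K := by
  obtain ⟨C, hC⟩ := hf_bdd
  obtain ⟨K, hK⟩ := hf_lip
  obtain ⟨D, hD⟩ := hg_bdd
  obtain ⟨L, hL⟩ := hg_lip
  have hR := isRegular_indicator hC hf_cont hK hD hL
  have hff' : ∀ t ∈ Icc 0 T, f t = (Icc 0 T).indicator f t := fun t ht =>
    (indicator_of_mem ht f).symm
  have hl : ∀ n, LipschitzOnWith _ (fun q : ℝ × EuclideanSpace ℝ (Fin d) =>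
      lowerValD U V f g P (prt n) q.1 q.2) (Icc 0 T ×ˢ univ) := fun n =>
    lipschitzOnWith_of_abs_sub_le (le_max_right C 0) fun t t' ht htt' ht' x x' => by
      rw [lowerValD_congr hff' ht, lowerValD_congr hff' (ht.trans htt')]
      exact hR.abs_lowerValD_sub_le ht htt' ht' x x'
  have hu : ∀ n, LipschitzOnWith _ (fun q : ℝ × EuclideanSpace ℝ (Fin d) =>
      upperValD U V f g P (prt n) q.1 q.2) (Icc 0 T ×ˢ univ) := fun n =>
    lipschitzOnWith_of_abs_sub_le (le_max_right C 0) fun t t' ht htt' ht' x x' => by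
      rw [upperValD_congr hff' ht, upperValD_congr hff' (ht.trans htt')]
      exact hR.abs_upperValD_sub_le ht htt' ht' x x'
  obtain ⟨φ, hφ, G, hGlip, hGb, hG⟩ := exists_subseq_tendstoUniformlyOn (c := (0 : ℝ × ℝ)) (D := D)
    (fun n => (hl n).prodMk (hu n)) fun n q hq => by
      rw [mem_closedBall_zero_iff, Prod.norm_def, lowerValD_congr hff' hq.1.1,
        upperValD_congr hff' hq.1.1]
      exact max_le (hR.abs_lowerValD_le hq.1 _) (hR.abs_upperValD_le hq.1 _)
  refine ⟨φ, hφ, fun t x => (G (t, x)).1, fun t x => (G (t, x)).2, ⟨D, fun t ht x => ?_⟩,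
    ⟨_, LipschitzWith.prod_fst.comp_lipschitzOnWith hGlip,
      LipschitzWith.prod_snd.comp_lipschitzOnWith hGlip⟩,
    fun S hS hST => ?_⟩
  · have h := mem_closedBall_zero_iff.1 (hGb (t, x) ⟨ht, mem_univ x⟩)
    exact ⟨(norm_fst_le _).trans h, (norm_snd_le _).trans h⟩
  · have h := hG S hS hST
    exact ⟨uniformContinuous_fst.comp_tendstoUniformlyOn h,
      uniformContinuous_snd.comp_tendstoUniformlyOn h⟩

end DGameFormal
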